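/- Let c ∈ C⁴(cl U × cl V) satisfy (B0)–(B3), fix ȳ ∈ cl V, and let u = u^{c*c} be c-convex on cl U. Then the modified potential ũ(q) := u(x(q)) + c(x(q), ȳ) has convex level sets as a function of the cost-exponential coordinates q ∈ cl U_ȳ. Moreover ũ(q) + M_c|q|² is convex, where M_c := (β_c⁻)² ‖D²_{xx} c‖_{L∞(U×V)} + (β_c⁻)³ ‖D_x c‖_{L∞(U×V)} ‖D²_{xx} D_y c‖_{L∞(U×V)}. If in addition c is non-negatively cross-curved (B4), then ũ is convex on cl U_ȳ. In either case ũ is minimized at q₀ whenever ȳ ∈ ∂ᶜu(x(q₀)). Furthermore, ũ is c̃-convex with respect to the modified cost c̃(q, y) := c(x(q), y) − c(x(q), ȳ) on cl U_ȳ × cl V, and ∂^{c̃}ũ(q) = ∂ᶜu(x(q)) for all q ∈ cl U_ȳ. -/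

import Mathlib

open Set MeasureTheory Metric Bornology
open scoped ENNReal NNReal Pointwise

noncomputable section

abbrev Euc (n : ℕ) := EuclideanSpace ℝ (Fin n)

/-- Partial gradient of the cost in the first variable: `D_x c(x,y)`. -/
noncomputable def gradX (n : ℕ) (c : Euc n → Euc n → ℝ) (x y : Euc n) : Euc n :=
  gradient (fun x' => c x' y) x

/-- Partial gradient of the cost in the second variable: `D_y c(x,y)`. -/
noncomputable def gradY (n : ℕ) (c : Euc n → Euc n → ℝ) (x y : Euc n) : Euc n :=
  gradient (fun y' => c x y') y

/-- Mixed second derivative `D²_{xy} c` as a continuous linear map. -/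
noncomputable def DxyC (n : ℕ) (c : Euc n → Euc n → ℝ) (x y : Euc n) : Euc n →L[ℝ] Euc n :=
  fderiv ℝ (fun x' => gradY n c x' y) x

/-- Second derivative `D²_{xx} c`. -/
noncomputable def DxxC (n : ℕ) (c : Euc n → Euc n → ℝ) (x y : Euc n) : Euc n →L[ℝ] Euc n :=
  fderiv ℝ (fun x' => gradX n c x' y) x

/-- Third derivative `D²_{xx} D_y c`. -/
noncomputable def DxxyC (n : ℕ) (c : Euc n → Euc n → ℝ) (x y : Euc n) :
    Euc n →L[ℝ] Euc n →L[ℝ] Euc n :=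
  fderiv ℝ (fun x' => DxyC n c x' y) x

/-- `β⁺_c = ‖D²_{xy} c‖_{L∞(U×V)}`. -/
noncomputable def betaPlus (n : ℕ) (c : Euc n → Euc n → ℝ) (U V : Set (Euc n)) : ℝ :=
  sSup ((fun p : Euc n × Euc n => ‖DxyC n c p.1 p.2‖) '' (U ×ˢ V))

/-- `β⁻_c = ‖(D²_{xy} c)⁻¹‖_{L∞(U×V)}`. -/
noncomputable def betaMinus (n : ℕ) (c : Euc n → Euc n → ℝ) (U V : Set (Euc n)) : ℝ :=
  sSup ((fun p : Euc n × Euc n => ‖(DxyC n c p.1 p.2).inverse‖) '' (U ×ˢ V))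

/-- `γ⁺_c = ‖det D²_{xy} c‖_{L∞(U×V)}`. -/
noncomputable def gammaPlus (n : ℕ) (c : Euc n → Euc n → ℝ) (U V : Set (Euc n)) : ℝ :=
  sSup ((fun p : Euc n × Euc n =>
    |LinearMap.det ((DxyC n c p.1 p.2 : Euc n →L[ℝ] Euc n) : Euc n →ₗ[ℝ] Euc n)|) '' (U ×ˢ V))

/-- `γ⁻_c = ‖(det D²_{xy} c)⁻¹‖_{L∞(U×V)}`. -/
noncomputable def gammaMinus (n : ℕ) (c : Euc n → Euc n → ℝ) (U V : Set (Euc n)) : ℝ :=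
  sSup ((fun p : Euc n × Euc n =>
    |LinearMap.det ((DxyC n c p.1 p.2 : Euc n →L[ℝ] Euc n) : Euc n →ₗ[ℝ] Euc n)|⁻¹) '' (U ×ˢ V))

noncomputable def supDxx (n : ℕ) (c : Euc n → Euc n → ℝ) (U V : Set (Euc n)) : ℝ :=
  sSup ((fun p : Euc n × Euc n => ‖DxxC n c p.1 p.2‖) '' (U ×ˢ V))

noncomputable def supDx (n : ℕ) (c : Euc n → Euc n → ℝ) (U V : Set (Euc n)) : ℝ :=
  sSup ((fun p : Euc n × Euc n => ‖gradX n c p.1 p.2‖) '' (U ×ˢ V))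

noncomputable def supDxxy (n : ℕ) (c : Euc n → Euc n → ℝ) (U V : Set (Euc n)) : ℝ :=
  sSup ((fun p : Euc n × Euc n => ‖DxxyC n c p.1 p.2‖) '' (U ×ˢ V))

/-- The constant `M_c` from Theorem 4.3. -/
noncomputable def Mconst (n : ℕ) (c : Euc n → Euc n → ℝ) (U V : Set (Euc n)) : ℝ :=
  (betaMinus n c U V) ^ 2 * supDxx n c U V +
    (betaMinus n c U V) ^ 3 * supDx n c U V * supDxxy n c U V

/-- The constant `ε_c` of Lemma 6.1: `1/ε_c = 2 (β⁺)⁴ (β⁻)⁶ ‖D³_{xxy} c‖_∞`. -/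
noncomputable def epsC (n : ℕ) (c : Euc n → Euc n → ℝ) (U V : Set (Euc n)) : ℝ :=
  (2 * (betaPlus n c U V) ^ 4 * (betaMinus n c U V) ^ 6 * supDxxy n c U V)⁻¹

/-- Condition (B0). -/
def B0cond (n : ℕ) (c : Euc n → Euc n → ℝ) (U V : Set (Euc n)) : Prop :=
  IsOpen U ∧ IsBounded U ∧ IsOpen V ∧ IsBounded V ∧
    ContDiffOn ℝ 4 (Function.uncurry c) (closure U ×ˢ closure V)

/-- `f` is a (C¹-) diffeomorphism from `S` onto its range. -/
def DiffeoOnto (n : ℕ) (f : Euc n → Euc n) (S : Set (Euc n)) : Prop :=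
  Set.InjOn f S ∧ ContDiffOn ℝ 1 f S ∧ ContDiffOn ℝ 1 (Function.invFunOn f S) (f '' S)

/-- Condition (B1) (bi-twist). -/
def B1cond (n : ℕ) (c : Euc n → Euc n → ℝ) (U V : Set (Euc n)) : Prop :=
  (∀ y ∈ closure V, DiffeoOnto n (fun x => -gradY n c x y) (closure U)) ∧
  (∀ x ∈ closure U, DiffeoOnto n (fun y => -gradX n c x y) (closure V))

/-- `U_ȳ := -D_y c(U, ȳ)`. -/
def Uyset (n : ℕ) (c : Euc n → Euc n → ℝ) (U : Set (Euc n)) (ybar : Euc n) : Set (Euc n) :=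
  (fun x => -gradY n c x ybar) '' U

/-- `V_x̄ := -D_x c(x̄, V)`. -/
def Vxset (n : ℕ) (c : Euc n → Euc n → ℝ) (V : Set (Euc n)) (xbar : Euc n) : Set (Euc n) :=
  (fun y => -gradX n c xbar y) '' V

/-- Condition (B2) (bi-convexity). -/
def B2cond (n : ℕ) (c : Euc n → Euc n → ℝ) (U V : Set (Euc n)) : Prop :=
  (∀ y ∈ closure V, Convex ℝ (Uyset n c U y)) ∧ (∀ x ∈ closure U, Convex ℝ (Vxset n c V x))

/-- A strongly convex set: each boundary point is touched from outside by a sphere of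
radius `R` enclosing the set. -/
def StronglyConvexSet (n : ℕ) (Q : Set (Euc n)) : Prop :=
  Convex ℝ Q ∧ ∃ R : ℝ, 0 < R ∧ ∀ x ∈ frontier Q, ∃ z : Euc n, dist x z = R ∧ Q ⊆ closedBall z R

/-- Condition (B2s). -/
def B2scond (n : ℕ) (c : Euc n → Euc n → ℝ) (U V : Set (Euc n)) : Prop :=
  (∀ y ∈ closure V, StronglyConvexSet n (Uyset n c U y)) ∧
  (∀ x ∈ closure U, StronglyConvexSet n (Vxset n c V x))

/-- An affinely parameterized line segment on `[-1,1]`. -/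
def IsAffineSeg (n : ℕ) (F : ℝ → Euc n × Euc n) : Prop :=
  ∃ a b : Euc n × Euc n, ∀ t ∈ Icc (-1 : ℝ) 1, F t = a + t • b

/-- `∂²/∂s∂t c(x(s), y(t))` at `(0,0)`. -/
noncomputable def crossDiff2 (n : ℕ) (c : Euc n → Euc n → ℝ) (x y : ℝ → Euc n) : ℝ :=
  deriv (fun s => deriv (fun t => c (x s) (y t)) 0) 0

/-- `∂⁴/∂s²∂t² c(x(s), y(t))` at `(0,0)`. -/
noncomputable def crossDiff4 (n : ℕ) (c : Euc n → Euc n → ℝ) (x y : ℝ → Euc n) : ℝ :=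
  deriv (deriv (fun s => deriv (deriv (fun t => c (x s) (y t))) 0)) 0

/-- Condition (B3) (= A3w). -/
def B3cond (n : ℕ) (c : Euc n → Euc n → ℝ) (U V : Set (Euc n)) : Prop :=
  ∀ x y : ℝ → Euc n, (∀ t ∈ Icc (-1 : ℝ) 1, x t ∈ closure U) →
    (∀ t ∈ Icc (-1 : ℝ) 1, y t ∈ closure V) →
    IsAffineSeg n (fun t => (gradY n c (x t) (y 0), gradX n c (x 0) (y t))) →
    crossDiff2 n c x y = 0 → crossDiff4 n c x y ≤ 0

/-- Condition (B4) (non-negative cross-curvature). -/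
def B4cond (n : ℕ) (c : Euc n → Euc n → ℝ) (U V : Set (Euc n)) : Prop :=
  ∀ x y : ℝ → Euc n, (∀ t ∈ Icc (-1 : ℝ) 1, x t ∈ closure U) →
    (∀ t ∈ Icc (-1 : ℝ) 1, y t ∈ closure V) →
    IsAffineSeg n (fun t => (gradY n c (x t) (y 0), gradX n c (x 0) (y t))) →
    crossDiff4 n c x y ≤ 0

/-- The `c*`-transform `u^{c*}(y) = sup_{x ∈ A} (-c(x,y) - u(x))`. -/
noncomputable def cStarT (n : ℕ) (c : Euc n → Euc n → ℝ) (A : Set (Euc n)) (u : Euc n → ℝ)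
    (y : Euc n) : ℝ :=
  sSup ((fun x => -c x y - u x) '' A)

/-- `u` is `c`-convex on `A` (relative to the target set `B`): `u = (u^{c*})^c`. -/
def CConvexOn (n : ℕ) (c : Euc n → Euc n → ℝ) (A B : Set (Euc n)) (u : Euc n → ℝ) : Prop :=
  ∀ x ∈ A, u x = sSup ((fun y => -c x y - cStarT n c A u y) '' B)

/-- The `c`-subdifferential `∂ᶜu ⊂ A × B`. -/
def cSubdiff (n : ℕ) (c : Euc n → Euc n → ℝ) (A B : Set (Euc n)) (u : Euc n → ℝ) :
    Set (Euc n × Euc n) :=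
  {p | p.1 ∈ A ∧ p.2 ∈ B ∧ u p.1 + cStarT n c A u p.2 + c p.1 p.2 = 0}

def cSubdiffAt (n : ℕ) (c : Euc n → Euc n → ℝ) (A B : Set (Euc n)) (u : Euc n → ℝ)
    (x : Euc n) : Set (Euc n) :=
  {y | (x, y) ∈ cSubdiff n c A B u}

def cSubdiffImg (n : ℕ) (c : Euc n → Euc n → ℝ) (A B : Set (Euc n)) (u : Euc n → ℝ)
    (X : Set (Euc n)) : Set (Euc n) :=
  ⋃ x ∈ X, cSubdiffAt n c A B u x

/-- `∂^{c*}u^{c*}(Y) = {x : ∃ y ∈ Y, (x,y) ∈ ∂ᶜu}`. -/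
def cSubdiffPre (n : ℕ) (c : Euc n → Euc n → ℝ) (A B : Set (Euc n)) (u : Euc n → ℝ)
    (Y : Set (Euc n)) : Set (Euc n) :=
  {x | ∃ y ∈ Y, (x, y) ∈ cSubdiff n c A B u}

/-- `|∂ᶜu| ≥ lam` on `S`. -/
def MAge (n : ℕ) (c : Euc n → Euc n → ℝ) (A B : Set (Euc n)) (u : Euc n → ℝ) (lam : ℝ)
    (S : Set (Euc n)) : Prop :=
  ∀ X : Set (Euc n), X ⊆ S → MeasurableSet X →
    ENNReal.ofReal lam * volume X ≤ volume (cSubdiffImg n c A B u X)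

/-- `|∂ᶜu| ≤ lam` on `S`. -/
def MAle (n : ℕ) (c : Euc n → Euc n → ℝ) (A B : Set (Euc n)) (u : Euc n → ℝ) (lam : ℝ)
    (S : Set (Euc n)) : Prop :=
  ∀ X : Set (Euc n), X ⊆ S → MeasurableSet X →
    volume (cSubdiffImg n c A B u X) ≤ ENNReal.ofReal lam * volume X

/-- The inverse of the cost-exponential coordinate change `q(x) = -D_y c(x, ȳ)`. -/
noncomputable def xOf (n : ℕ) (c : Euc n → Euc n → ℝ) (U : Set (Euc n)) (ybar : Euc n) :
    Euc n → Euc n :=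
  Function.invFunOn (fun x => -gradY n c x ybar) (closure U)

/-- `cl U_ȳ := -D_y c(cl U, ȳ)`. -/
def clUy (n : ℕ) (c : Euc n → Euc n → ℝ) (U : Set (Euc n)) (ybar : Euc n) : Set (Euc n) :=
  (fun x => -gradY n c x ybar) '' closure U

/-- The modified cost `c̃(q,y) = c(x(q), y) - c(x(q), ȳ)`. -/
noncomputable def modCost (n : ℕ) (c : Euc n → Euc n → ℝ) (U : Set (Euc n)) (ybar : Euc n)
    (q y : Euc n) : ℝ :=
  c (xOf n c U ybar q) y - c (xOf n c U ybar q) ybar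

/-- The modified potential `ũ(q) = u(x(q)) + c(x(q), ȳ)`. -/
noncomputable def modPot (n : ℕ) (c : Euc n → Euc n → ℝ) (U : Set (Euc n)) (ybar : Euc n)
    (u : Euc n → ℝ) (q : Euc n) : ℝ :=
  u (xOf n c U ybar q) + c (xOf n c U ybar q) ybar

/-- The `c̃`-cone generated by `qt` and `Q` with height `-h0 > 0`. -/
noncomputable def cConeFun (n : ℕ) (ct : Euc n → Euc n → ℝ) (B Q : Set (Euc n)) (qt : Euc n)
    (h0 : ℝ) (q : Euc n) : ℝ :=
  sSup {r : ℝ | ∃ y ∈ B, r = -ct q y + ct qt y + h0 ∧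
    ∀ p ∈ frontier Q, -ct p y + ct qt y + h0 ≤ 0}

/-- The ordinary subdifferential `∂u(x)` relative to a domain `A`. -/
def subdiffAt (n : ℕ) (A : Set (Euc n)) (u : Euc n → ℝ) (x : Euc n) : Set (Euc n) :=
  {p | ∀ ε > 0, ∃ δ > 0, ∀ x' ∈ A, ‖x' - x‖ < δ →
    u x + @inner ℝ _ _ p (x' - x) - ε * ‖x' - x‖ ≤ u x'}

/-- The dual norm `‖v‖*_K = sup_{w ∈ K} ⟨w, v⟩`. -/
noncomputable def dualNorm (n : ℕ) (K : Set (Euc n)) (v : Euc n) : ℝ :=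
  sSup ((fun w => (@inner ℝ _ _ w v : ℝ)) '' K)

/-- The section `S(x̄, ȳ, τ)`. -/
def sectS (n : ℕ) (c : Euc n → Euc n → ℝ) (U : Set (Euc n)) (u : Euc n → ℝ)
    (xbar ybar : Euc n) (τ : ℝ) : Set (Euc n) :=
  {x ∈ U | u x ≤ u xbar - c x ybar + c xbar ybar + τ}

/-- The measure with density `f` restricted to `A`. -/
noncomputable def densMeasure (n : ℕ) (A : Set (Euc n)) (f : Euc n → ℝ) : Measure (Euc n) :=
  (volume.restrict A).withDensity fun x => ENNReal.ofReal (f x)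

end

section GeneralFacts

/-- An injective endomorphism of a finite dimensional space is invertible. -/
lemma clm_isInvertible_of_injective {E : Type*} [NormedAddCommGroup E] [NormedSpace ℝ E]
    [FiniteDimensional ℝ E] (L : E →L[ℝ] E) (hL : ∀ v, L v = 0 → v = 0) : L.IsInvertible := by
  have hinj : Function.Injective (L : E →ₗ[ℝ] E) := by
    rw [← LinearMap.ker_eq_bot, LinearMap.ker_eq_bot']
    exact hL
  let e := (LinearEquiv.ofInjectiveEndo (L : E →ₗ[ℝ] E) hinj).toContinuousLinearEquiv
  exact ⟨e, by ext v; rfl⟩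

/-- Global inverse function theorem for injective local diffeomorphisms. -/
lemma contDiffOn_invFunOn {E : Type*} [NormedAddCommGroup E] [NormedSpace ℝ E]
    [FiniteDimensional ℝ E] [Nonempty E] {k : WithTop ℕ∞} (hk : k ≠ 0) {f : E → E} {Ω : Set E}
    (hΩ : IsOpen Ω)
    (hf : ContDiffOn ℝ k f Ω) (hinj : InjOn f Ω)
    (hd : ∀ x ∈ Ω, ∀ v, fderiv ℝ f x v = 0 → v = 0) :
    IsOpen (f '' Ω) ∧ ContDiffOn ℝ k (Function.invFunOn f Ω) (f '' Ω) := by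
  haveI : CompleteSpace E := FiniteDimensional.complete ℝ E
  have key : ∀ x ∈ Ω, f '' Ω ∈ nhds (f x) ∧ ContDiffAt ℝ k (Function.invFunOn f Ω) (f x) := by
    intro x hx
    have hΩx : Ω ∈ nhds x := hΩ.mem_nhds hx
    have hfx : ContDiffAt ℝ k f x := hf.contDiffAt hΩx
    obtain ⟨e, he⟩ := clm_isInvertible_of_injective (fderiv ℝ f x) (hd x hx)
    have hdf : HasFDerivAt f (e : E →L[ℝ] E) x := by
      rw [he]; exact (hfx.differentiableAt hk).hasFDerivAt
    have hs : HasStrictFDerivAt f (e : E →L[ℝ] E) x := hfx.hasStrictFDerivAt' hdf hk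
    have hmap := hs.map_nhds_eq_of_equiv
    have himg : f '' Ω ∈ nhds (f x) := by
      rw [← hmap]; exact Filter.image_mem_map hΩx
    refine ⟨himg, ?_⟩
    have hloc : ContDiffAt ℝ k (hfx.localInverse hdf hk) (f x) := hfx.to_localInverse hdf hk
    have h1 : hfx.localInverse hdf hk (f x) = x := hfx.localInverse_apply_image hdf hk
    have h2 : ∀ᶠ z in nhds (f x), f (hfx.localInverse hdf hk z) = z :=
      hs.eventually_right_inverse
    have h3 : ∀ᶠ z in nhds (f x), hfx.localInverse hdf hk z ∈ Ω := by
      have := hloc.continuousAt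
      apply this.eventually_mem
      rw [h1]; exact hΩx
    refine hloc.congr_of_eventuallyEq ?_
    filter_upwards [h2, h3, himg] with z hz1 hz2 hz3
    apply hinj (Function.invFunOn_mem hz3) hz2
    rw [hz1]; exact Function.invFunOn_eq hz3
  constructor
  · rw [isOpen_iff_mem_nhds]
    rintro _ ⟨x, hx, rfl⟩
    exact (key x hx).1
  · rintro _ ⟨x, hx, rfl⟩
    exact (key x hx).2.contDiffWithinAt

/-- Left inverse differentiable: derivatives are injective. -/
lemma injective_of_diffeo {n : ℕ} {f : Euc n → Euc n} {S : Set (Euc n)} (h : DiffeoOnto n f S)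
    {x : Euc n} (hx : x ∈ S) (hu : UniqueDiffWithinAt ℝ S x) {f' : Euc n →L[ℝ] Euc n}
    (hf' : HasFDerivWithinAt f f' S x) : ∀ v, f' v = 0 → v = 0 := by
  obtain ⟨hinj, -, hg⟩ := h
  have hg' := ((hg.differentiableOn (by norm_num)) (f x) (mem_image_of_mem f hx)).hasFDerivWithinAt
  have hcomp := hg'.comp x hf' (mapsTo_image f S)
  have hid : HasFDerivWithinAt (Function.invFunOn f S ∘ f) (ContinuousLinearMap.id ℝ (Euc n)) S x := by
    refine (hasFDerivWithinAt_id x S).congr ?_ ?_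
    · intro z hz; exact hinj.leftInvOn_invFunOn hz
    · exact hinj.leftInvOn_invFunOn hx
  have heq := hu.eq hcomp hid
  intro v hv
  have := congrArg (fun L : Euc n →L[ℝ] Euc n => L v) heq
  simp only [ContinuousLinearMap.comp_apply, hv, map_zero] at this
  simpa using this.symm

lemma uniqueDiffOn_of_diffeo {n : ℕ} {f : Euc n → Euc n} {U : Set (Euc n)} (hU : IsOpen U)
    (hb : IsBounded U) (hne : U.Nonempty) (h : DiffeoOnto n f (closure U))
    (hconv : Convex ℝ (f '' U)) : UniqueDiffOn ℝ (closure U) := by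
  have hf := h.2.1
  have hg := h.2.2
  have hinj := h.1
  have hcl : f '' closure U = closure (f '' U) :=
    image_closure_of_isCompact hb.isCompact_closure hf.continuousOn
  have hopen : IsOpen (f '' U) := by
    refine (contDiffOn_invFunOn (k := 1) one_ne_zero hU (hf.mono subset_closure)
      (hinj.mono subset_closure) ?_).1
    intro x hx
    have hnh : closure U ∈ nhds x := Filter.mem_of_superset (hU.mem_nhds hx) subset_closure
    apply injective_of_diffeo h (subset_closure hx) (uniqueDiffWithinAt_of_mem_nhds hnh)
    exact ((hf.contDiffAt hnh).differentiableAt one_ne_zero).hasFDerivAt.hasFDerivWithinAt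
  have huq : UniqueDiffOn ℝ (f '' closure U) := by
    rw [hcl]
    apply uniqueDiffOn_convex hconv.closure
    obtain ⟨x, hx⟩ := hne
    exact ⟨f x, interior_maximal subset_closure hopen (mem_image_of_mem f hx)⟩
  intro x hx
  have hfx : f x ∈ f '' closure U := mem_image_of_mem f hx
  have hg' := ((hg.differentiableOn (by norm_num)) (f x) hfx).hasFDerivWithinAt
  have hgx : Function.invFunOn f (closure U) (f x) = x := hinj.leftInvOn_invFunOn hx
  have himg : Function.invFunOn f (closure U) '' (f '' closure U) = closure U :=
    hinj.invFunOn_image subset_rfl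
  have hf' := ((hf.differentiableOn (by norm_num)) x hx).hasFDerivWithinAt
  have hf'' := hf'
  rw [← hgx] at hf''
  have hcomp := HasFDerivWithinAt.comp (f x) hf'' hg' (by
    rw [mapsTo_iff_image_subset, himg])
  have hid : HasFDerivWithinAt (f ∘ Function.invFunOn f (closure U))
      (ContinuousLinearMap.id ℝ (Euc n)) (f '' closure U) (f x) := by
    refine (hasFDerivWithinAt_id _ _).congr ?_ ?_
    · intro z hz; exact Function.invFunOn_eq hz
    · exact Function.invFunOn_eq hfx
  have heq := (huq _ hfx).eq hcomp hid
  set g' := fderivWithin ℝ (Function.invFunOn f (closure U)) (f '' closure U) (f x)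
  have hginj : Function.Injective (g' : Euc n →ₗ[ℝ] Euc n) := by
    rw [← LinearMap.ker_eq_bot, LinearMap.ker_eq_bot']
    intro v hv
    have := congrArg (fun L : Euc n →L[ℝ] Euc n => L v) heq
    have hv' : g' v = 0 := hv
    simp only [ContinuousLinearMap.comp_apply, hv', map_zero] at this
    simpa using this.symm
  have hsurj : Function.Surjective g' := LinearMap.surjective_of_injective hginj
  have := hg'.uniqueDiffWithinAt (huq _ hfx) hsurj.denseRange
  rwa [himg, hgx] at this

end GeneralFacts

section Derivs

set_option maxSynthPendingDepth 4

variable {n : ℕ}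

/-- Iterated total derivatives of the cost on the product space. -/
noncomputable def K1 (c : Euc n → Euc n → ℝ) : Euc n × Euc n → (Euc n × Euc n →L[ℝ] ℝ) :=
  fderiv ℝ (Function.uncurry c)
noncomputable def K2 (c : Euc n → Euc n → ℝ) :
    Euc n × Euc n → (Euc n × Euc n →L[ℝ] Euc n × Euc n →L[ℝ] ℝ) :=
  fderiv ℝ (K1 c)
noncomputable def K3 (c : Euc n → Euc n → ℝ) :
    Euc n × Euc n → (Euc n × Euc n →L[ℝ] Euc n × Euc n →L[ℝ] Euc n × Euc n →L[ℝ] ℝ) :=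
  fderiv ℝ (K2 c)
noncomputable def K4 (c : Euc n → Euc n → ℝ) :
    Euc n × Euc n →
      (Euc n × Euc n →L[ℝ] Euc n × Euc n →L[ℝ] Euc n × Euc n →L[ℝ] Euc n × Euc n →L[ℝ] ℝ) :=
  fderiv ℝ (K3 c)

/-- Riesz representative of the second component of a functional. -/
noncomputable def Q2 (n : ℕ) : (Euc n × Euc n →L[ℝ] ℝ) →L[ℝ] Euc n :=
  LinearMap.toContinuousLinearMap
    { toFun := fun l => (InnerProductSpace.toDual ℝ (Euc n)).symm
        (l.comp (ContinuousLinearMap.inr ℝ (Euc n) (Euc n)))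
      map_add' := fun a b => by
        apply ext_inner_right ℝ; intro v
        simp [inner_add_left, InnerProductSpace.toDual_symm_apply]
      map_smul' := fun a b => by
        apply ext_inner_right ℝ; intro v
        simp [inner_smul_left, InnerProductSpace.toDual_symm_apply] }

/-- Riesz representative of the first component of a functional. -/
noncomputable def Q1 (n : ℕ) : (Euc n × Euc n →L[ℝ] ℝ) →L[ℝ] Euc n :=
  LinearMap.toContinuousLinearMap
    { toFun := fun l => (InnerProductSpace.toDual ℝ (Euc n)).symm
        (l.comp (ContinuousLinearMap.inl ℝ (Euc n) (Euc n)))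
      map_add' := fun a b => by
        apply ext_inner_right ℝ; intro v
        simp [inner_add_left, InnerProductSpace.toDual_symm_apply]
      map_smul' := fun a b => by
        apply ext_inner_right ℝ; intro v
        simp [inner_smul_left, InnerProductSpace.toDual_symm_apply] }

lemma inner_Q2 (l : Euc n × Euc n →L[ℝ] ℝ) (w : Euc n) : inner ℝ (Q2 n l) w = l (0, w) := by
  show inner ℝ ((InnerProductSpace.toDual ℝ (Euc n)).symm
    (l.comp (ContinuousLinearMap.inr ℝ (Euc n) (Euc n)))) w = _
  rw [InnerProductSpace.toDual_symm_apply]; simp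

lemma inner_Q1 (l : Euc n × Euc n →L[ℝ] ℝ) (w : Euc n) : inner ℝ (Q1 n l) w = l (w, 0) := by
  show inner ℝ ((InnerProductSpace.toDual ℝ (Euc n)).symm
    (l.comp (ContinuousLinearMap.inl ℝ (Euc n) (Euc n)))) w = _
  rw [InnerProductSpace.toDual_symm_apply]; simp

lemma eq_Q2 {l : Euc n × Euc n →L[ℝ] ℝ} {p : Euc n} (h : ∀ w, inner ℝ p w = l (0, w)) :
    p = Q2 n l := ext_inner_right ℝ fun w => by rw [h, inner_Q2]

lemma eq_Q1 {l : Euc n × Euc n →L[ℝ] ℝ} {p : Euc n} (h : ∀ w, inner ℝ p w = l (w, 0)) :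
    p = Q1 n l := ext_inner_right ℝ fun w => by rw [h, inner_Q1]

variable {c : Euc n → Euc n → ℝ} {Ω : Set (Euc n × Euc n)}

lemma contDiffOn_K1 (hΩ : IsOpen Ω) (hC : ContDiffOn ℝ 4 (Function.uncurry c) Ω) :
    ContDiffOn ℝ 3 (K1 c) Ω := hC.fderiv_of_isOpen hΩ (by norm_num)
lemma contDiffOn_K2 (hΩ : IsOpen Ω) (hC : ContDiffOn ℝ 4 (Function.uncurry c) Ω) :
    ContDiffOn ℝ 2 (K2 c) Ω := (contDiffOn_K1 hΩ hC).fderiv_of_isOpen hΩ (by norm_num)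
lemma contDiffOn_K3 (hΩ : IsOpen Ω) (hC : ContDiffOn ℝ 4 (Function.uncurry c) Ω) :
    ContDiffOn ℝ 1 (K3 c) Ω := (contDiffOn_K2 hΩ hC).fderiv_of_isOpen hΩ (by norm_num)

lemma hasFDerivAt_K0 (hΩ : IsOpen Ω) (hC : ContDiffOn ℝ 4 (Function.uncurry c) Ω)
    {z : Euc n × Euc n} (hz : z ∈ Ω) : HasFDerivAt (Function.uncurry c) (K1 c z) z :=
  ((hC.contDiffAt (hΩ.mem_nhds hz)).differentiableAt (by norm_num)).hasFDerivAt
lemma hasFDerivAt_K1 (hΩ : IsOpen Ω) (hC : ContDiffOn ℝ 4 (Function.uncurry c) Ω)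
    {z : Euc n × Euc n} (hz : z ∈ Ω) : HasFDerivAt (K1 c) (K2 c z) z :=
  (((contDiffOn_K1 hΩ hC).contDiffAt (hΩ.mem_nhds hz)).differentiableAt (by norm_num)).hasFDerivAt
lemma hasFDerivAt_K2 (hΩ : IsOpen Ω) (hC : ContDiffOn ℝ 4 (Function.uncurry c) Ω)
    {z : Euc n × Euc n} (hz : z ∈ Ω) : HasFDerivAt (K2 c) (K3 c z) z :=
  (((contDiffOn_K2 hΩ hC).contDiffAt (hΩ.mem_nhds hz)).differentiableAt (by norm_num)).hasFDerivAt
lemma hasFDerivAt_K3 (hΩ : IsOpen Ω) (hC : ContDiffOn ℝ 4 (Function.uncurry c) Ω)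
    {z : Euc n × Euc n} (hz : z ∈ Ω) : HasFDerivAt (K3 c) (K4 c z) z :=
  (((contDiffOn_K3 hΩ hC).contDiffAt (hΩ.mem_nhds hz)).differentiableAt (by norm_num)).hasFDerivAt

lemma K2_symm (hΩ : IsOpen Ω) (hC : ContDiffOn ℝ 4 (Function.uncurry c) Ω)
    {z : Euc n × Euc n} (hz : z ∈ Ω) (a b : Euc n × Euc n) : K2 c z a b = K2 c z b a :=
  second_derivative_symmetric_of_eventually
    (by filter_upwards [hΩ.mem_nhds hz] with y hy using hasFDerivAt_K0 hΩ hC hy)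
    (hasFDerivAt_K1 hΩ hC hz) a b

lemma K3_symm12 (hΩ : IsOpen Ω) (hC : ContDiffOn ℝ 4 (Function.uncurry c) Ω)
    {z : Euc n × Euc n} (hz : z ∈ Ω) (a b d : Euc n × Euc n) : K3 c z a b d = K3 c z b a d := by
  rw [second_derivative_symmetric_of_eventually
    (by filter_upwards [hΩ.mem_nhds hz] with y hy using hasFDerivAt_K1 hΩ hC hy)
    (hasFDerivAt_K2 hΩ hC hz) a b]

lemma K4_symm12 (hΩ : IsOpen Ω) (hC : ContDiffOn ℝ 4 (Function.uncurry c) Ω)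
    {z : Euc n × Euc n} (hz : z ∈ Ω) (a b d e : Euc n × Euc n) :
    K4 c z a b d e = K4 c z b a d e := by
  rw [second_derivative_symmetric_of_eventually
    (by filter_upwards [hΩ.mem_nhds hz] with y hy using hasFDerivAt_K2 hΩ hC hy)
    (hasFDerivAt_K3 hΩ hC hz) a b]

lemma K3_symm23 (hΩ : IsOpen Ω) (hC : ContDiffOn ℝ 4 (Function.uncurry c) Ω)
    {z : Euc n × Euc n} (hz : z ∈ Ω) (a b d : Euc n × Euc n) : K3 c z a b d = K3 c z a d b := by
  have h1 := ((hasFDerivAt_K2 hΩ hC hz).clm_apply (hasFDerivAt_const b z)).clm_apply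
    (hasFDerivAt_const d z)
  have h2 := ((hasFDerivAt_K2 hΩ hC hz).clm_apply (hasFDerivAt_const d z)).clm_apply
    (hasFDerivAt_const b z)
  have h3 := h1.congr_of_eventuallyEq (f₁ := fun y => K2 c y d b) (by
    filter_upwards [hΩ.mem_nhds hz] with y hy using K2_symm hΩ hC hy d b)
  have := congrArg (fun L : Euc n × Euc n →L[ℝ] ℝ => L a) (h3.unique h2)
  simpa using this

lemma K4_symm23 (hΩ : IsOpen Ω) (hC : ContDiffOn ℝ 4 (Function.uncurry c) Ω)
    {z : Euc n × Euc n} (hz : z ∈ Ω) (a b d e : Euc n × Euc n) :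
    K4 c z a b d e = K4 c z a d b e := by
  have h1 := (((hasFDerivAt_K3 hΩ hC hz).clm_apply (hasFDerivAt_const b z)).clm_apply
    (hasFDerivAt_const d z)).clm_apply (hasFDerivAt_const e z)
  have h2 := (((hasFDerivAt_K3 hΩ hC hz).clm_apply (hasFDerivAt_const d z)).clm_apply
    (hasFDerivAt_const b z)).clm_apply (hasFDerivAt_const e z)
  have h3 := h1.congr_of_eventuallyEq (f₁ := fun y => K3 c y d b e) (by
    filter_upwards [hΩ.mem_nhds hz] with y hy using K3_symm12 hΩ hC hy d b e)
  have := congrArg (fun L : Euc n × Euc n →L[ℝ] ℝ => L a) (h3.unique h2)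
  simpa using this

lemma K4_symm34 (hΩ : IsOpen Ω) (hC : ContDiffOn ℝ 4 (Function.uncurry c) Ω)
    {z : Euc n × Euc n} (hz : z ∈ Ω) (a b d e : Euc n × Euc n) :
    K4 c z a b d e = K4 c z a b e d := by
  have h1 := (((hasFDerivAt_K3 hΩ hC hz).clm_apply (hasFDerivAt_const b z)).clm_apply
    (hasFDerivAt_const d z)).clm_apply (hasFDerivAt_const e z)
  have h2 := (((hasFDerivAt_K3 hΩ hC hz).clm_apply (hasFDerivAt_const b z)).clm_apply
    (hasFDerivAt_const e z)).clm_apply (hasFDerivAt_const d z)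
  have h3 := h1.congr_of_eventuallyEq (f₁ := fun y => K3 c y b e d) (by
    filter_upwards [hΩ.mem_nhds hz] with y hy using K3_symm23 hΩ hC hy b e d)
  have := congrArg (fun L : Euc n × Euc n →L[ℝ] ℝ => L a) (h3.unique h2)
  simpa using this

lemma K4_swap (hΩ : IsOpen Ω) (hC : ContDiffOn ℝ 4 (Function.uncurry c) Ω)
    {z : Euc n × Euc n} (hz : z ∈ Ω) (v w : Euc n × Euc n) :
    K4 c z v v w w = K4 c z w w v v := by
  rw [K4_symm23 hΩ hC hz v v w w, K4_symm12 hΩ hC hz v w v w, K4_symm34 hΩ hC hz w v v w,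
    K4_symm23 hΩ hC hz w v w v]

lemma K3_rot (hΩ : IsOpen Ω) (hC : ContDiffOn ℝ 4 (Function.uncurry c) Ω)
    {z : Euc n × Euc n} (hz : z ∈ Ω) (v w : Euc n × Euc n) :
    K3 c z v v w = K3 c z w v v := by
  rw [K3_symm23 hΩ hC hz v v w, K3_symm12 hΩ hC hz v w v]

/-- slices -/
lemma hasFDerivAt_mkl {G : Type*} [NormedAddCommGroup G] [NormedSpace ℝ G]
    {N : Euc n × Euc n → G} {x y : Euc n} {N' : Euc n × Euc n →L[ℝ] G}
    (h : HasFDerivAt N N' (x, y)) :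
    HasFDerivAt (fun x' => N (x', y)) (N'.comp (ContinuousLinearMap.inl ℝ (Euc n) (Euc n))) x :=
  h.comp x (hasFDerivAt_prodMk_left x y)
lemma hasFDerivAt_mkr {G : Type*} [NormedAddCommGroup G] [NormedSpace ℝ G]
    {N : Euc n × Euc n → G} {x y : Euc n} {N' : Euc n × Euc n →L[ℝ] G}
    (h : HasFDerivAt N N' (x, y)) :
    HasFDerivAt (fun y' => N (x, y')) (N'.comp (ContinuousLinearMap.inr ℝ (Euc n) (Euc n))) y :=
  h.comp y (hasFDerivAt_prodMk_right x y)

lemma gradX_eq (hΩ : IsOpen Ω) (hC : ContDiffOn ℝ 4 (Function.uncurry c) Ω) {x y : Euc n}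
    (hz : (x, y) ∈ Ω) : gradX n c x y = Q1 n (K1 c (x, y)) := by
  apply eq_Q1
  intro w
  have := (hasFDerivAt_mkl (hasFDerivAt_K0 hΩ hC hz)).fderiv
  unfold gradX
  rw [inner_gradient_left]
  have h2 : (fun x' => c x' y) = fun x' => Function.uncurry c (x', y) := rfl
  rw [h2, this]; simp

lemma gradY_eq (hΩ : IsOpen Ω) (hC : ContDiffOn ℝ 4 (Function.uncurry c) Ω) {x y : Euc n}
    (hz : (x, y) ∈ Ω) : gradY n c x y = Q2 n (K1 c (x, y)) := by
  apply eq_Q2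
  intro w
  have := (hasFDerivAt_mkr (hasFDerivAt_K0 hΩ hC hz)).fderiv
  unfold gradY
  rw [inner_gradient_left]
  have h2 : (fun x' => c x x') = fun y' => Function.uncurry c (x, y') := rfl
  rw [h2, this]; simp

/-- The operator `v ↦ D_x D_y c v` extracted from a bilinear form. -/
noncomputable def PQ (n : ℕ) (Q : (Euc n × Euc n →L[ℝ] ℝ) →L[ℝ] Euc n) :
    (Euc n × Euc n →L[ℝ] Euc n × Euc n →L[ℝ] ℝ) →L[ℝ] (Euc n →L[ℝ] Euc n) :=
  ((ContinuousLinearMap.compL ℝ (Euc n) (Euc n × Euc n) (Euc n)).flip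
      (ContinuousLinearMap.inl ℝ (Euc n) (Euc n))).comp
    (ContinuousLinearMap.compL ℝ (Euc n × Euc n) (Euc n × Euc n →L[ℝ] ℝ) (Euc n) Q)

lemma PQ_apply (Q : (Euc n × Euc n →L[ℝ] ℝ) →L[ℝ] Euc n)
    (B : Euc n × Euc n →L[ℝ] Euc n × Euc n →L[ℝ] ℝ) (v : Euc n) :
    PQ n Q B v = Q (B (v, 0)) := rfl

lemma nhds_slice_l (hΩ : IsOpen Ω) {x y : Euc n} (hz : (x, y) ∈ Ω) :
    ∀ᶠ x' in nhds x, (x', y) ∈ Ω :=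
  (Continuous.prodMk_left y).continuousAt.eventually_mem (hΩ.mem_nhds hz)
lemma nhds_slice_r (hΩ : IsOpen Ω) {x y : Euc n} (hz : (x, y) ∈ Ω) :
    ∀ᶠ y' in nhds y, (x, y') ∈ Ω :=
  (Continuous.prodMk_right x).continuousAt.eventually_mem (hΩ.mem_nhds hz)

lemma hasFDerivAt_gradY_l (hΩ : IsOpen Ω) (hC : ContDiffOn ℝ 4 (Function.uncurry c) Ω) {x y : Euc n}
    (hz : (x, y) ∈ Ω) :
    HasFDerivAt (fun x' => gradY n c x' y) (PQ n (Q2 n) (K2 c (x, y))) x := by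
  have h := (Q2 n).hasFDerivAt.comp x (hasFDerivAt_mkl (hasFDerivAt_K1 hΩ hC hz))
  refine HasFDerivAt.congr_of_eventuallyEq h ?_
  filter_upwards [nhds_slice_l hΩ hz] with x' hx' using gradY_eq hΩ hC hx'

lemma DxyC_eq (hΩ : IsOpen Ω) (hC : ContDiffOn ℝ 4 (Function.uncurry c) Ω) {x y : Euc n}
    (hz : (x, y) ∈ Ω) : DxyC n c x y = PQ n (Q2 n) (K2 c (x, y)) :=
  (hasFDerivAt_gradY_l hΩ hC hz).fderiv

lemma DxxC_eq (hΩ : IsOpen Ω) (hC : ContDiffOn ℝ 4 (Function.uncurry c) Ω) {x y : Euc n}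
    (hz : (x, y) ∈ Ω) : DxxC n c x y = PQ n (Q1 n) (K2 c (x, y)) := by
  have h := (Q1 n).hasFDerivAt.comp x (hasFDerivAt_mkl (hasFDerivAt_K1 hΩ hC hz))
  refine (HasFDerivAt.congr_of_eventuallyEq h ?_).fderiv
  filter_upwards [nhds_slice_l hΩ hz] with x' hx' using gradX_eq hΩ hC hx'

lemma DxxyC_eq (hΩ : IsOpen Ω) (hC : ContDiffOn ℝ 4 (Function.uncurry c) Ω) {x y : Euc n}
    (hz : (x, y) ∈ Ω) : DxxyC n c x y =
      (PQ n (Q2 n)).comp ((K3 c (x, y)).comp (ContinuousLinearMap.inl ℝ (Euc n) (Euc n))) := by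
  have h := (PQ n (Q2 n)).hasFDerivAt.comp x (hasFDerivAt_mkl (hasFDerivAt_K2 hΩ hC hz))
  refine (HasFDerivAt.congr_of_eventuallyEq h ?_).fderiv
  filter_upwards [nhds_slice_l hΩ hz] with x' hx' using DxyC_eq hΩ hC hx'

lemma inner_DxyC (hΩ : IsOpen Ω) (hC : ContDiffOn ℝ 4 (Function.uncurry c) Ω) {x y : Euc n}
    (hz : (x, y) ∈ Ω) (v w : Euc n) :
    inner ℝ (DxyC n c x y v) w = K2 c (x, y) (v, 0) (0, w) := by
  rw [DxyC_eq hΩ hC hz, PQ_apply, inner_Q2]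
lemma inner_DxxC (hΩ : IsOpen Ω) (hC : ContDiffOn ℝ 4 (Function.uncurry c) Ω) {x y : Euc n}
    (hz : (x, y) ∈ Ω) (v w : Euc n) :
    inner ℝ (DxxC n c x y v) w = K2 c (x, y) (v, 0) (w, 0) := by
  rw [DxxC_eq hΩ hC hz, PQ_apply, inner_Q1]
lemma inner_DxxyC (hΩ : IsOpen Ω) (hC : ContDiffOn ℝ 4 (Function.uncurry c) Ω) {x y : Euc n}
    (hz : (x, y) ∈ Ω) (v v' w : Euc n) :
    inner ℝ (DxxyC n c x y v v') w = K3 c (x, y) (v, 0) (v', 0) (0, w) := by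
  rw [DxxyC_eq hΩ hC hz]
  show inner ℝ (PQ n (Q2 n) (K3 c (x, y) (v, 0)) v') w = _
  rw [PQ_apply, inner_Q2]

end Derivs

section Interior

set_option maxSynthPendingDepth 4

variable {n : ℕ}

/-- Interior consequences of (B0)-(B2). -/
structure Nice (n : ℕ) (c : Euc n → Euc n → ℝ) (U V : Set (Euc n)) : Prop where
  oU : IsOpen U
  oV : IsOpen V
  hC : ContDiffOn ℝ 4 (Function.uncurry c) (U ×ˢ V)
  N1 : ∀ z ∈ U ×ˢ V, ∀ v : Euc n, (∀ w, K2 c z (v, 0) (0, w) = 0) → v = 0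
  N2 : ∀ z ∈ U ×ˢ V, ∀ w : Euc n, (∀ v, K2 c z (0, w) (v, 0) = 0) → w = 0
  injX : ∀ y ∈ V, InjOn (fun x => -gradY n c x y) U
  injY : ∀ x ∈ U, InjOn (fun y => -gradX n c x y) V
  convX : ∀ y ∈ V, Convex ℝ (Uyset n c U y)
  convY : ∀ x ∈ U, Convex ℝ (Vxset n c V x)

noncomputable def Phi1 (c : Euc n → Euc n → ℝ) (z : Euc n × Euc n) : Euc n × Euc n :=
  (z.1, -gradX n c z.1 z.2)
noncomputable def Phi2 (c : Euc n → Euc n → ℝ) (z : Euc n × Euc n) : Euc n × Euc n :=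
  (-gradY n c z.1 z.2, z.2)
noncomputable def H1 (c : Euc n → Euc n → ℝ) (U V : Set (Euc n)) : Euc n × Euc n → Euc n × Euc n :=
  Function.invFunOn (Phi1 c) (U ×ˢ V)
noncomputable def H2 (c : Euc n → Euc n → ℝ) (U V : Set (Euc n)) : Euc n × Euc n → Euc n × Euc n :=
  Function.invFunOn (Phi2 c) (U ×ˢ V)

variable {c : Euc n → Euc n → ℝ} {U V : Set (Euc n)}

lemma Nice.oO (h : Nice n c U V) : IsOpen (U ×ˢ V) := h.oU.prod h.oV

lemma Nice.injPhi1 (h : Nice n c U V) : InjOn (Phi1 c) (U ×ˢ V) := by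
  rintro ⟨x, y⟩ hz ⟨x', y'⟩ hz' heq
  simp only [Phi1, Prod.mk.injEq] at heq
  obtain ⟨rfl, h2⟩ := heq
  exact Prod.ext rfl (h.injY x hz.1 hz.2 hz'.2 h2)

lemma Nice.injPhi2 (h : Nice n c U V) : InjOn (Phi2 c) (U ×ˢ V) := by
  rintro ⟨x, y⟩ hz ⟨x', y'⟩ hz' heq
  simp only [Phi2, Prod.mk.injEq] at heq
  obtain ⟨h2, rfl⟩ := heq
  exact Prod.ext (h.injX y hz.2 hz.1 hz'.1 h2) rfl

lemma Nice.H1_contDiff (h : Nice n c U V) :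
    IsOpen (Phi1 c '' (U ×ˢ V)) ∧ ContDiffOn ℝ 3 (H1 c U V) (Phi1 c '' (U ×ˢ V)) := by
  have heq : ∀ z ∈ U ×ˢ V, Phi1 c z = (z.1, -Q1 n (K1 c z)) := by
    rintro ⟨x, y⟩ hz
    simp only [Phi1]; rw [gradX_eq h.oO h.hC hz]
  apply contDiffOn_invFunOn (by norm_num) h.oO _ h.injPhi1
  · intro z hz v hv
    have hd : HasFDerivAt (Phi1 c) ((ContinuousLinearMap.fst ℝ (Euc n) (Euc n)).prod
        (-((Q1 n).comp (K2 c z)))) z := by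
      have h0 : HasFDerivAt (fun z : Euc n × Euc n => (z.1, -Q1 n (K1 c z)))
          ((ContinuousLinearMap.fst ℝ (Euc n) (Euc n)).prod (-((Q1 n).comp (K2 c z)))) z :=
        hasFDerivAt_fst.prodMk (((Q1 n).hasFDerivAt.comp z (hasFDerivAt_K1 h.oO h.hC hz)).neg)
      refine h0.congr_of_eventuallyEq ?_
      filter_upwards [h.oO.mem_nhds hz] with z' hz' using heq z' hz'
    rw [hd.fderiv] at hv
    obtain ⟨v1, v2⟩ := v
    simp only [ContinuousLinearMap.prod_apply, Prod.mk_eq_zero] at hv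
    obtain ⟨h1, h2⟩ := hv
    have h1' : v1 = 0 := h1
    subst h1'
    have h3 : v2 = 0 := by
      apply h.N2 z hz
      intro v'
      have h4 : Q1 n (K2 c z (0, v2)) = 0 := neg_eq_zero.mp h2
      rw [← inner_Q1, h4, inner_zero_left]
    rw [h3]; rfl
  · refine ContDiffOn.congr ?_ heq
    exact contDiffOn_fst.prodMk ((Q1 n).contDiff.comp_contDiffOn (contDiffOn_K1 h.oO h.hC)).neg

lemma Nice.H2_contDiff (h : Nice n c U V) :
    IsOpen (Phi2 c '' (U ×ˢ V)) ∧ ContDiffOn ℝ 3 (H2 c U V) (Phi2 c '' (U ×ˢ V)) := by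
  have heq : ∀ z ∈ U ×ˢ V, Phi2 c z = (-Q2 n (K1 c z), z.2) := by
    rintro ⟨x, y⟩ hz
    simp only [Phi2]; rw [gradY_eq h.oO h.hC hz]
  apply contDiffOn_invFunOn (by norm_num) h.oO _ h.injPhi2
  · intro z hz v hv
    have hd : HasFDerivAt (Phi2 c) ((-((Q2 n).comp (K2 c z))).prod
        (ContinuousLinearMap.snd ℝ (Euc n) (Euc n))) z := by
      have h0 : HasFDerivAt (fun z : Euc n × Euc n => (-Q2 n (K1 c z), z.2))
          ((-((Q2 n).comp (K2 c z))).prod (ContinuousLinearMap.snd ℝ (Euc n) (Euc n))) z :=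
        (((Q2 n).hasFDerivAt.comp z (hasFDerivAt_K1 h.oO h.hC hz)).neg).prodMk hasFDerivAt_snd
      refine h0.congr_of_eventuallyEq ?_
      filter_upwards [h.oO.mem_nhds hz] with z' hz' using heq z' hz'
    rw [hd.fderiv] at hv
    obtain ⟨v1, v2⟩ := v
    simp only [ContinuousLinearMap.prod_apply, Prod.mk_eq_zero] at hv
    obtain ⟨h2, h1⟩ := hv
    have h1' : v2 = 0 := h1
    subst h1'
    have h3 : v1 = 0 := by
      apply h.N1 z hz
      intro v'
      have h4 : Q2 n (K2 c z (v1, 0)) = 0 := neg_eq_zero.mp h2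
      rw [← inner_Q2, h4, inner_zero_left]
    rw [h3]; rfl
  · refine ContDiffOn.congr ?_ heq
    exact ((Q2 n).contDiff.comp_contDiffOn (contDiffOn_K1 h.oO h.hC)).neg.prodMk contDiffOn_snd

lemma Nice.H1_spec (h : Nice n c U V) {z : Euc n × Euc n} (hz : z ∈ Phi1 c '' (U ×ˢ V)) :
    H1 c U V z ∈ U ×ˢ V ∧ (H1 c U V z).1 = z.1 ∧
      gradX n c (H1 c U V z).1 (H1 c U V z).2 = - z.2 := by
  have h1 : H1 c U V z ∈ U ×ˢ V := Function.invFunOn_mem hz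
  have h2 : Phi1 c (H1 c U V z) = z := Function.invFunOn_eq hz
  have h0 : (Phi1 c (H1 c U V z)).1 = z.1 := congrArg Prod.fst h2
  refine ⟨h1, h0, ?_⟩
  have h3 : -gradX n c (H1 c U V z).1 (H1 c U V z).2 = z.2 := congrArg Prod.snd h2
  rw [← h3, neg_neg]

lemma Nice.H2_spec (h : Nice n c U V) {z : Euc n × Euc n} (hz : z ∈ Phi2 c '' (U ×ˢ V)) :
    H2 c U V z ∈ U ×ˢ V ∧ (H2 c U V z).2 = z.2 ∧
      gradY n c (H2 c U V z).1 (H2 c U V z).2 = - z.1 := by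
  have h1 : H2 c U V z ∈ U ×ˢ V := Function.invFunOn_mem hz
  have h2 : Phi2 c (H2 c U V z) = z := Function.invFunOn_eq hz
  have h0 : (Phi2 c (H2 c U V z)).2 = z.2 := congrArg Prod.snd h2
  refine ⟨h1, h0, ?_⟩
  have h3 : -gradY n c (H2 c U V z).1 (H2 c U V z).2 = z.1 := congrArg Prod.fst h2
  rw [← h3, neg_neg]

lemma Nice.H1_Phi (h : Nice n c U V) {z : Euc n × Euc n} (hz : z ∈ U ×ˢ V) :
    H1 c U V (Phi1 c z) = z := h.injPhi1.leftInvOn_invFunOn hz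
lemma Nice.H2_Phi (h : Nice n c U V) {z : Euc n × Euc n} (hz : z ∈ U ×ˢ V) :
    H2 c U V (Phi2 c z) = z := h.injPhi2.leftInvOn_invFunOn hz

lemma Nice.H1_K1 (h : Nice n c U V) {z : Euc n × Euc n} (hz : z ∈ Phi1 c '' (U ×ˢ V)) (v : Euc n) :
    K1 c (H1 c U V z) (v, 0) = - inner ℝ z.2 v := by
  obtain ⟨h1, -, h3⟩ := h.H1_spec hz
  have h4 : gradX n c (H1 c U V z).1 (H1 c U V z).2 = Q1 n (K1 c (H1 c U V z)) :=
    gradX_eq h.oO h.hC (x := (H1 c U V z).1) (y := (H1 c U V z).2) h1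
  rw [← inner_Q1, ← h4, h3, inner_neg_left]

lemma Nice.H2_K1 (h : Nice n c U V) {z : Euc n × Euc n} (hz : z ∈ Phi2 c '' (U ×ˢ V)) (v : Euc n) :
    K1 c (H2 c U V z) (0, v) = - inner ℝ z.1 v := by
  obtain ⟨h1, -, h3⟩ := h.H2_spec hz
  have h4 : gradY n c (H2 c U V z).1 (H2 c U V z).2 = Q2 n (K1 c (H2 c U V z)) :=
    gradY_eq h.oO h.hC (x := (H2 c U V z).1) (y := (H2 c U V z).2) h1
  rw [← inner_Q2, ← h4, h3, inner_neg_left]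

lemma hda_const {Z G : Type*} [NormedAddCommGroup Z] [NormedSpace ℝ Z] [NormedAddCommGroup G]
    [NormedSpace ℝ G] {A : ℝ → Z →L[ℝ] G} {A' : Z →L[ℝ] G} {s : ℝ} (h : HasDerivAt A A' s) (ξ : Z) :
    HasDerivAt (fun r => A r ξ) (A' ξ) s := by
  simpa using h.clm_apply (hasDerivAt_const s ξ)

lemma hda_chain {Z G : Type*} [NormedAddCommGroup Z] [NormedSpace ℝ Z] [NormedAddCommGroup G]
    [NormedSpace ℝ G] {N : Z → G} {N' : Z →L[ℝ] G} {γ : ℝ → Z} {g : Z} {s : ℝ}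
    (h : HasFDerivAt N N' (γ s)) (hγ : HasDerivAt γ g s) :
    HasDerivAt (fun r => N (γ r)) (N' g) s := h.comp_hasDerivAt s hγ

lemma hda_app {Z G : Type*} [NormedAddCommGroup Z] [NormedSpace ℝ Z] [NormedAddCommGroup G]
    [NormedSpace ℝ G] {A : ℝ → Z →L[ℝ] G} {A' : Z →L[ℝ] G} {b : ℝ → Z} {b' : Z} {s : ℝ}
    (h : HasDerivAt A A' s) (hb : HasDerivAt b b' s) :
    HasDerivAt (fun r => A r (b r)) (A' (b s) + A s b') s := h.clm_apply hb

lemma hda_app_const {Z G : Type*} [NormedAddCommGroup Z] [NormedSpace ℝ Z] [NormedAddCommGroup G]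
    [NormedSpace ℝ G] {A : ℝ → Z →L[ℝ] Z →L[ℝ] G} {A' : Z →L[ℝ] Z →L[ℝ] G} {b : ℝ → Z} {b' : Z}
    {s : ℝ} (h : HasDerivAt A A' s) (hb : HasDerivAt b b' s) (ξ : Z) :
    HasDerivAt (fun r => A r (b r) ξ) (A' (b s) ξ + A s b' ξ) s := by
  simpa using hda_const (hda_app h hb) ξ

lemma K0_curve {Ω : Set (Euc n × Euc n)} (hΩ : IsOpen Ω)
    (hC : ContDiffOn ℝ 4 (Function.uncurry c) Ω) {Z : ℝ → Euc n × Euc n} {s : ℝ}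
    {z' : Euc n × Euc n} (hz : Z s ∈ Ω) (hZ : HasDerivAt Z z' s) :
    HasDerivAt (fun r => Function.uncurry c (Z r)) (K1 c (Z s) z') s :=
  hda_chain (hasFDerivAt_K0 hΩ hC hz) hZ
lemma K1_curve {Ω : Set (Euc n × Euc n)} (hΩ : IsOpen Ω)
    (hC : ContDiffOn ℝ 4 (Function.uncurry c) Ω) {Z : ℝ → Euc n × Euc n} {s : ℝ}
    {z' : Euc n × Euc n} (hz : Z s ∈ Ω) (hZ : HasDerivAt Z z' s) :
    HasDerivAt (fun r => K1 c (Z r)) (K2 c (Z s) z') s :=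
  hda_chain (hasFDerivAt_K1 hΩ hC hz) hZ
lemma K2_curve {Ω : Set (Euc n × Euc n)} (hΩ : IsOpen Ω)
    (hC : ContDiffOn ℝ 4 (Function.uncurry c) Ω) {Z : ℝ → Euc n × Euc n} {s : ℝ}
    {z' : Euc n × Euc n} (hz : Z s ∈ Ω) (hZ : HasDerivAt Z z' s) :
    HasDerivAt (fun r => K2 c (Z r)) (K3 c (Z s) z') s :=
  hda_chain (hasFDerivAt_K2 hΩ hC hz) hZ
lemma K3_curve {Ω : Set (Euc n × Euc n)} (hΩ : IsOpen Ω)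
    (hC : ContDiffOn ℝ 4 (Function.uncurry c) Ω) {Z : ℝ → Euc n × Euc n} {s : ℝ}
    {z' : Euc n × Euc n} (hz : Z s ∈ Ω) (hZ : HasDerivAt Z z' s) :
    HasDerivAt (fun r => K3 c (Z r)) (K4 c (Z s) z') s :=
  hda_chain (hasFDerivAt_K3 hΩ hC hz) hZ

set_option maxHeartbeats 1000000 in
/-- The curve through the inverse map, with all its derivative identities. -/
lemma affine_curve {Ω W : Set (Euc n × Euc n)} (hΩ : IsOpen Ω)
    (hC : ContDiffOn ℝ 4 (Function.uncurry c) Ω) (hW : IsOpen W)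
    {H : Euc n × Euc n → Euc n × Euc n} (hH : ContDiffOn ℝ 3 H W) (hm : ∀ z ∈ W, H z ∈ Ω)
    (z0 ζ : Euc n × Euc n) {s : ℝ} (hs : z0 + s • ζ ∈ W) :
    HasDerivAt (fun s => H (z0 + s • ζ)) (deriv (fun s => H (z0 + s • ζ)) s) s ∧
    HasDerivAt (deriv (fun s => H (z0 + s • ζ))) (deriv (deriv (fun s => H (z0 + s • ζ))) s) s ∧
    (∀ (ξ : Euc n × Euc n) (L : Euc n × Euc n →L[ℝ] ℝ), (∀ z ∈ W, K1 c (H z) ξ = L z) →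
      K2 c (H (z0 + s • ζ)) (deriv (fun s => H (z0 + s • ζ)) s) ξ = L ζ ∧
      K3 c (H (z0 + s • ζ)) (deriv (fun s => H (z0 + s • ζ)) s)
          (deriv (fun s => H (z0 + s • ζ)) s) ξ +
        K2 c (H (z0 + s • ζ)) (deriv (deriv (fun s => H (z0 + s • ζ))) s) ξ = 0) ∧
    (∀ M : Euc n × Euc n →L[ℝ] Euc n, (∀ z ∈ W, M (H z) = M z) → M ζ = 0 →
      M (deriv (fun s => H (z0 + s • ζ)) s) = 0 ∧
      M (deriv (deriv (fun s => H (z0 + s • ζ))) s) = 0) := by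
  set Z := fun s : ℝ => H (z0 + s • ζ) with hZ
  have hlin : ContDiff ℝ 3 (fun s : ℝ => z0 + s • ζ) := by fun_prop
  have hcont : Continuous (fun s : ℝ => z0 + s • ζ) := by fun_prop
  have hopen : IsOpen ((fun s : ℝ => z0 + s • ζ) ⁻¹' W) := hW.preimage hcont
  have hZc : ∀ r : ℝ, z0 + r • ζ ∈ W → ContDiffAt ℝ 3 Z r := fun r hr =>
    (hH.contDiffAt (hW.mem_nhds hr)).comp r hlin.contDiffAt
  have hZon : ContDiffOn ℝ 3 Z ((fun s : ℝ => z0 + s • ζ) ⁻¹' W) := fun r hr =>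
    (hZc r hr).contDiffWithinAt
  have hZ1 : ∀ r : ℝ, z0 + r • ζ ∈ W → HasDerivAt Z (deriv Z r) r := fun r hr =>
    ((hZc r hr).differentiableAt (by norm_num)).hasDerivAt
  have hZ2 : HasDerivAt (deriv Z) (deriv (deriv Z) s) s := by
    have := hZon.deriv_of_isOpen (m := 2) hopen (by norm_num)
    exact ((this.contDiffAt (hopen.mem_nhds hs)).differentiableAt (by norm_num)).hasDerivAt
  have hev : ∀ᶠ r in nhds s, z0 + r • ζ ∈ W := hopen.mem_nhds hs
  have hℓ : ∀ r : ℝ, HasDerivAt (fun s : ℝ => z0 + s • ζ) ζ r := fun r => by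
    simpa using ((hasDerivAt_id r).smul_const ζ).const_add z0
  refine ⟨hZ1 s hs, hZ2, ?_, ?_⟩
  · intro ξ L hL
    have hk2 : ∀ r : ℝ, z0 + r • ζ ∈ W → K2 c (Z r) (deriv Z r) ξ = L ζ := by
      intro r hr
      have hevr : ∀ᶠ r' in nhds r, z0 + r' • ζ ∈ W := hopen.mem_nhds hr
      have h1 : HasDerivAt (fun r => K1 c (Z r) ξ) (K2 c (Z r) (deriv Z r) ξ) r := by
        exact hda_const (hda_chain (hasFDerivAt_K1 hΩ hC (hm _ hr)) (hZ1 r hr)) ξ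
      have h2 : HasDerivAt (fun r : ℝ => L (z0 + r • ζ)) (L ζ) r :=
        L.hasFDerivAt.comp_hasDerivAt r (hℓ r)
      refine h1.unique (h2.congr_of_eventuallyEq ?_)
      filter_upwards [hevr] with r' hr' using hL _ hr'
    refine ⟨hk2 s hs, ?_⟩
    have h1 : HasDerivAt (fun r => K2 c (Z r) (deriv Z r) ξ)
        (K3 c (Z s) (deriv Z s) (deriv Z s) ξ + K2 c (Z s) (deriv (deriv Z) s) ξ) s := by
      have hA := K2_curve hΩ hC (hm _ hs) (hZ1 s hs)
      exact hda_app_const (A := fun r => K2 c (Z r)) (A' := K3 c (Z s) (deriv Z s)) (b := deriv Z)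
        (b' := deriv (deriv Z) s) (s := s) hA hZ2 ξ
    refine h1.unique ((hasDerivAt_const s (L ζ)).congr_of_eventuallyEq ?_)
    filter_upwards [hev] with r hr using hk2 r hr
  · intro M hM hMζ
    have hk : ∀ r : ℝ, z0 + r • ζ ∈ W → M (deriv Z r) = 0 := by
      intro r hr
      have hevr : ∀ᶠ r' in nhds r, z0 + r' • ζ ∈ W := hopen.mem_nhds hr
      have h1 : HasDerivAt (fun r => M (Z r)) (M (deriv Z r)) r :=
        hda_chain (N := M) (γ := Z) M.hasFDerivAt (hZ1 r hr)
      have h2 : HasDerivAt (fun r : ℝ => M (z0 + r • ζ)) (M ζ) r :=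
        M.hasFDerivAt.comp_hasDerivAt r (hℓ r)
      rw [hMζ] at h2
      refine h1.unique (h2.congr_of_eventuallyEq ?_)
      filter_upwards [hevr] with r' hr' using hM _ hr'
    refine ⟨hk s hs, ?_⟩
    have h1 : HasDerivAt (fun r => M (deriv Z r)) (M (deriv (deriv Z) s)) s :=
      hda_chain (N := M) (γ := deriv Z) M.hasFDerivAt hZ2
    refine h1.unique ((hasDerivAt_const s (0 : Euc n)).congr_of_eventuallyEq ?_)
    filter_upwards [hev] with r hr using hk r hr

/-- Specialization to y-curves. -/
lemma Nice.ycurve (h : Nice n c U V) (x0 p d : Euc n) {t : ℝ}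
    (ht : (x0, p) + t • ((0 : Euc n), d) ∈ Phi1 c '' (U ×ˢ V)) :
    ∃ w b : Euc n,
    HasDerivAt (fun s : ℝ => H1 c U V ((x0, p) + s • ((0 : Euc n), d))) ((0 : Euc n), w) t ∧
    HasDerivAt (deriv (fun s : ℝ => H1 c U V ((x0, p) + s • ((0 : Euc n), d)))) ((0 : Euc n), b) t ∧
    (∀ v, K2 c (H1 c U V ((x0, p) + t • ((0 : Euc n), d))) (0, w) (v, 0) = - inner ℝ d v) ∧
    (∀ v, K3 c (H1 c U V ((x0, p) + t • ((0 : Euc n), d))) (0, w) (0, w) (v, 0) +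
      K2 c (H1 c U V ((x0, p) + t • ((0 : Euc n), d))) (0, b) (v, 0) = 0) := by
  obtain ⟨h1, h2, h3, h4⟩ := affine_curve (c := c) h.oO h.hC h.H1_contDiff.1 h.H1_contDiff.2
    (fun z hz => (h.H1_spec hz).1) (x0, p) ((0 : Euc n), d) ht
  set Z := (fun s : ℝ => H1 c U V ((x0, p) + s • ((0 : Euc n), d))) with hZ
  obtain ⟨h5, h6⟩ := h4 (ContinuousLinearMap.fst ℝ (Euc n) (Euc n))
    (fun z hz => (h.H1_spec hz).2.1) rfl
  have e1 : deriv Z t = ((0 : Euc n), (deriv Z t).2) := Prod.ext h5 rfl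
  have e2 : deriv (deriv Z) t = ((0 : Euc n), (deriv (deriv Z) t).2) := Prod.ext h6 rfl
  have hL : ∀ v : Euc n, ∀ z ∈ Phi1 c '' (U ×ˢ V), K1 c (H1 c U V z) (v, 0) =
      (-((innerSL ℝ v).comp (ContinuousLinearMap.snd ℝ (Euc n) (Euc n)))) z := by
    intro v z hz
    rw [h.H1_K1 hz]
    simp [real_inner_comm]
  rw [e1] at h1 h3
  rw [e2] at h2 h3
  refine ⟨_, _, h1, h2, fun v => ?_, fun v => ?_⟩
  · rw [(h3 _ _ (hL v)).1]; simp [real_inner_comm]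
  · exact (h3 _ _ (hL v)).2

lemma Nice.xcurve (h : Nice n c U V) (q y0 e : Euc n) {t : ℝ}
    (ht : (q, y0) + t • (e, (0 : Euc n)) ∈ Phi2 c '' (U ×ˢ V)) :
    ∃ w b : Euc n,
    HasDerivAt (fun s : ℝ => H2 c U V ((q, y0) + s • (e, (0 : Euc n)))) (w, (0 : Euc n)) t ∧
    HasDerivAt (deriv (fun s : ℝ => H2 c U V ((q, y0) + s • (e, (0 : Euc n))))) (b, (0 : Euc n)) t ∧
    (∀ v, K2 c (H2 c U V ((q, y0) + t • (e, (0 : Euc n)))) (w, 0) (0, v) = - inner ℝ e v) ∧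
    (∀ v, K3 c (H2 c U V ((q, y0) + t • (e, (0 : Euc n)))) (w, 0) (w, 0) (0, v) +
      K2 c (H2 c U V ((q, y0) + t • (e, (0 : Euc n)))) (b, 0) (0, v) = 0) := by
  obtain ⟨h1, h2, h3, h4⟩ := affine_curve (c := c) h.oO h.hC h.H2_contDiff.1 h.H2_contDiff.2
    (fun z hz => (h.H2_spec hz).1) (q, y0) (e, (0 : Euc n)) ht
  set Z := (fun s : ℝ => H2 c U V ((q, y0) + s • (e, (0 : Euc n)))) with hZ
  obtain ⟨h5, h6⟩ := h4 (ContinuousLinearMap.snd ℝ (Euc n) (Euc n))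
    (fun z hz => (h.H2_spec hz).2.1) rfl
  have e1 : deriv Z t = ((deriv Z t).1, (0 : Euc n)) := Prod.ext rfl h5
  have e2 : deriv (deriv Z) t = ((deriv (deriv Z) t).1, (0 : Euc n)) := Prod.ext rfl h6
  have hL : ∀ v : Euc n, ∀ z ∈ Phi2 c '' (U ×ˢ V), K1 c (H2 c U V z) (0, v) =
      (-((innerSL ℝ v).comp (ContinuousLinearMap.fst ℝ (Euc n) (Euc n)))) z := by
    intro v z hz
    rw [h.H2_K1 hz]
    simp [real_inner_comm]
  rw [e1] at h1 h3
  rw [e2] at h2 h3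
  refine ⟨_, _, h1, h2, fun v => ?_, fun v => ?_⟩
  · rw [(h3 _ _ (hL v)).1]; simp [real_inner_comm]
  · exact (h3 _ _ (hL v)).2

end Interior

section Mtw

set_option maxSynthPendingDepth 4

variable {n : ℕ} {c : Euc n → Euc n → ℝ} {U V : Set (Euc n)}

lemma hda_app_const2 {Z G : Type*} [NormedAddCommGroup Z] [NormedSpace ℝ Z] [NormedAddCommGroup G]
    [NormedSpace ℝ G] {A : ℝ → Z →L[ℝ] Z →L[ℝ] Z →L[ℝ] G} {A' : Z →L[ℝ] Z →L[ℝ] Z →L[ℝ] G}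
    {b : ℝ → Z} {b' : Z}
    {s : ℝ} (h : HasDerivAt A A' s) (hb : HasDerivAt b b' s) (ξ η : Z) :
    HasDerivAt (fun r => A r (b r) ξ η) (A' (b s) ξ η + A s b' ξ η) s := by
  simpa using hda_const (hda_const (hda_app h hb) ξ) η

lemma hda_const2 {Z G : Type*} [NormedAddCommGroup Z] [NormedSpace ℝ Z] [NormedAddCommGroup G]
    [NormedSpace ℝ G] {A : ℝ → Z →L[ℝ] Z →L[ℝ] G} {A' : Z →L[ℝ] Z →L[ℝ] G}
    {s : ℝ} (h : HasDerivAt A A' s) (ξ η : Z) :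
    HasDerivAt (fun r => A r ξ η) (A' ξ η) s := hda_const (hda_const h ξ) η

lemma hda_pair_l {s : ℝ} {X : ℝ → Euc n} {v : Euc n} (h : HasDerivAt X v s) (y : Euc n) :
    HasDerivAt (fun r => (X r, y)) (v, (0 : Euc n)) s := h.prodMk (hasDerivAt_const s y)
lemma hda_pair_r {s : ℝ} {X : ℝ → Euc n} {v : Euc n} (h : HasDerivAt X v s) (y : Euc n) :
    HasDerivAt (fun r => (y, X r)) ((0 : Euc n), v) s := (hasDerivAt_const s y).prodMk h

/-- second `t`-derivative of the cost along a curve in `y`. -/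
lemma cross_inner (hU : IsOpen U) (hV : IsOpen V)
    (hC : ContDiffOn ℝ 4 (Function.uncurry c) (U ×ˢ V)) {Y : ℝ → Euc n} {w b : Euc n}
    (hY0 : Y 0 ∈ V) (hY1 : ∀ᶠ t in nhds (0 : ℝ), HasDerivAt Y (deriv Y t) t)
    (hw : deriv Y 0 = w) (hb : HasDerivAt (deriv Y) b 0) {x : Euc n} (hx : x ∈ U) :
    deriv (fun t => c x (Y t)) 0 = K1 c (x, Y 0) (0, w) ∧
    deriv (deriv (fun t => c x (Y t))) 0 =
      K2 c (x, Y 0) (0, w) (0, w) + K1 c (x, Y 0) (0, b) := by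
  have hΩ : IsOpen (U ×ˢ V) := hU.prod hV
  have hd : ∀ t, Y t ∈ V → HasDerivAt Y (deriv Y t) t →
      HasDerivAt (fun t => c x (Y t)) (K1 c (x, Y t) (0, deriv Y t)) t := fun t ht h =>
    K0_curve hΩ hC (Z := fun t => (x, Y t)) (mk_mem_prod hx ht) (hda_pair_r h x)
  have hYc : ContinuousAt Y 0 := hY1.self_of_nhds.continuousAt
  have hev : ∀ᶠ t in nhds (0:ℝ), Y t ∈ V := hYc (hV.mem_nhds hY0)
  have e1 : deriv (fun t => c x (Y t)) =ᶠ[nhds 0] fun t => K1 c (x, Y t) (0, deriv Y t) := by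
    filter_upwards [hev, hY1] with t h1 h2 using (hd t h1 h2).deriv
  refine ⟨?_, ?_⟩
  · rw [e1.self_of_nhds]; simp only [hw]
  · rw [e1.deriv_eq]
    have h1 := hda_app (K1_curve hΩ hC (Z := fun t => (x, Y t)) (s := 0) (mk_mem_prod hx hY0)
      (hda_pair_r hY1.self_of_nhds x)) (hda_pair_r hb (0 : Euc n))
    rw [h1.deriv]
    rw [hw]

lemma cross_eval (hU : IsOpen U) (hV : IsOpen V)
    (hC : ContDiffOn ℝ 4 (Function.uncurry c) (U ×ˢ V)) {X Y : ℝ → Euc n} {v a w b : Euc n}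
    (hX0 : X 0 ∈ U) (hX1 : ∀ᶠ t in nhds (0 : ℝ), HasDerivAt X (deriv X t) t)
    (hv : deriv X 0 = v) (ha : HasDerivAt (deriv X) a 0)
    (hY0 : Y 0 ∈ V) (hY1 : ∀ᶠ t in nhds (0 : ℝ), HasDerivAt Y (deriv Y t) t)
    (hw : deriv Y 0 = w) (hb : HasDerivAt (deriv Y) b 0) :
    crossDiff2 n c X Y = K2 c (X 0, Y 0) (v, 0) (0, w) ∧
    crossDiff4 n c X Y = (K4 c (X 0, Y 0) (v, 0) (v, 0) (0, w) (0, w) +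
      K3 c (X 0, Y 0) (a, 0) (0, w) (0, w)) +
      (K3 c (X 0, Y 0) (v, 0) (v, 0) (0, b) + K2 c (X 0, Y 0) (a, 0) (0, b)) := by
  have hΩ : IsOpen (U ×ˢ V) := hU.prod hV
  have hXc : ContinuousAt X 0 := hX1.self_of_nhds.continuousAt
  have hev : ∀ᶠ t in nhds (0:ℝ), X t ∈ U := hXc (hU.mem_nhds hX0)
  have hX1' := hX1.self_of_nhds
  rw [hv] at hX1'
  constructor
  · unfold crossDiff2
    have e1 : (fun s => deriv (fun t => c (X s) (Y t)) 0) =ᶠ[nhds 0]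
        fun s => K1 c (X s, Y 0) (0, w) := by
      filter_upwards [hev] with s hs using (cross_inner hU hV hC hY0 hY1 hw hb hs).1
    rw [e1.deriv_eq]
    exact (hda_const (K1_curve hΩ hC (Z := fun s => (X s, Y 0)) (s := 0) (mk_mem_prod hX0 hY0)
      (hda_pair_l hX1' (Y 0))) (0, w)).deriv
  · unfold crossDiff4
    have e1 : (fun s => deriv (deriv (fun t => c (X s) (Y t))) 0) =ᶠ[nhds 0]
        fun s => K2 c (X s, Y 0) (0, w) (0, w) + K1 c (X s, Y 0) (0, b) := by
      filter_upwards [hev] with s hs using (cross_inner hU hV hC hY0 hY1 hw hb hs).2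
    have e2 : deriv (fun s => K2 c (X s, Y 0) (0, w) (0, w) + K1 c (X s, Y 0) (0, b))
        =ᶠ[nhds 0] fun s => K3 c (X s, Y 0) (deriv X s, 0) (0, w) (0, w) +
          K2 c (X s, Y 0) (deriv X s, 0) (0, b) := by
      filter_upwards [hev, hX1] with s hs hs1
      have hZ := hda_pair_l hs1 (Y 0)
      have h1 := K2_curve hΩ hC (Z := fun s => (X s, Y 0)) (s := s) (mk_mem_prod hs hY0) hZ
      have h2 := K1_curve hΩ hC (Z := fun s => (X s, Y 0)) (s := s) (mk_mem_prod hs hY0) hZ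
      exact ((hda_const2 h1 (0, w) (0, w)).add (hda_const h2 (0, b))).deriv
    rw [(e1.deriv.trans e2).deriv_eq]
    have hZ := hda_pair_l hX1' (Y 0)
    have h3 := K3_curve hΩ hC (Z := fun s => (X s, Y 0)) (s := 0) (mk_mem_prod hX0 hY0) hZ
    have h2 := K2_curve hΩ hC (Z := fun s => (X s, Y 0)) (s := 0) (mk_mem_prod hX0 hY0) hZ
    have hb' := hda_pair_l ha (0 : Euc n)
    have h4 := hda_app_const2 (A := fun s => K3 c (X s, Y 0)) (s := 0) h3 hb' (0, w) (0, w)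
    have h5 := hda_app_const (A := fun s => K2 c (X s, Y 0)) (s := 0) h2 hb' (0, b)
    have h6 := (h4.add h5).deriv
    rw [hv] at h6
    exact h6

end Mtw

section Mtw2

set_option maxSynthPendingDepth 4

variable {n : ℕ} {c : Euc n → Euc n → ℝ} {U V : Set (Euc n)}

/-- The Hessian in the coordinates `(x, p)`. -/
noncomputable def Bq (c : Euc n → Euc n → ℝ) (U V : Set (Euc n)) (z : Euc n × Euc n) :
    Euc n × Euc n →L[ℝ] Euc n × Euc n →L[ℝ] ℝ := K2 c (H1 c U V z)

noncomputable def Bq1 (c : Euc n → Euc n → ℝ) (U V : Set (Euc n)) :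
    Euc n × Euc n → (Euc n × Euc n →L[ℝ] Euc n × Euc n →L[ℝ] Euc n × Euc n →L[ℝ] ℝ) :=
  fderiv ℝ (Bq c U V)

noncomputable def Bq2 (c : Euc n → Euc n → ℝ) (U V : Set (Euc n)) :
    Euc n × Euc n →
      (Euc n × Euc n →L[ℝ] Euc n × Euc n →L[ℝ] Euc n × Euc n →L[ℝ] Euc n × Euc n →L[ℝ] ℝ) :=
  fderiv ℝ (Bq1 c U V)

lemma Nice.Bq_contDiff (h : Nice n c U V) : ContDiffOn ℝ 2 (Bq c U V) (Phi1 c '' (U ×ˢ V)) := by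
  have h1 := contDiffOn_K2 h.oO h.hC
  exact h1.comp (h.H1_contDiff.2.of_le (by norm_num)) (fun z hz => (h.H1_spec hz).1)

lemma Nice.Bq1_contDiff (h : Nice n c U V) : ContDiffOn ℝ 1 (Bq1 c U V) (Phi1 c '' (U ×ˢ V)) :=
  h.Bq_contDiff.fderiv_of_isOpen h.H1_contDiff.1 (by norm_num)

lemma Nice.Bq2_cont (h : Nice n c U V) : ContinuousOn (Bq2 c U V) (Phi1 c '' (U ×ˢ V)) :=
  (h.Bq1_contDiff.fderiv_of_isOpen (m := 0) h.H1_contDiff.1 (by norm_num)).continuousOn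

lemma Nice.hasFDerivAt_Bq (h : Nice n c U V) {z : Euc n × Euc n} (hz : z ∈ Phi1 c '' (U ×ˢ V)) :
    HasFDerivAt (Bq c U V) (Bq1 c U V z) z :=
  ((h.Bq_contDiff.contDiffAt (h.H1_contDiff.1.mem_nhds hz)).differentiableAt
    (by norm_num)).hasFDerivAt

lemma Nice.hasFDerivAt_Bq1 (h : Nice n c U V) {z : Euc n × Euc n} (hz : z ∈ Phi1 c '' (U ×ˢ V)) :
    HasFDerivAt (Bq1 c U V) (Bq2 c U V z) z :=
  ((h.Bq1_contDiff.contDiffAt (h.H1_contDiff.1.mem_nhds hz)).differentiableAt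
    (by norm_num)).hasFDerivAt

lemma hda_line {Z : Type*} [NormedAddCommGroup Z] [NormedSpace ℝ Z] (z0 ζ : Z) (r : ℝ) :
    HasDerivAt (fun s : ℝ => z0 + s • ζ) ζ r := by
  simpa using ((hasDerivAt_id r).smul_const ζ).const_add z0

lemma Nice.Bq_line1 (h : Nice n c U V) {z0 ζ : Euc n × Euc n} {t : ℝ}
    (hz : z0 + t • ζ ∈ Phi1 c '' (U ×ˢ V)) :
    HasDerivAt (fun s : ℝ => Bq c U V (z0 + s • ζ)) (Bq1 c U V (z0 + t • ζ) ζ) t :=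
  hda_chain (N := Bq c U V) (γ := fun s : ℝ => z0 + s • ζ) (h.hasFDerivAt_Bq hz) (hda_line z0 ζ t)

lemma Nice.Bq_line2 (h : Nice n c U V) {z0 ζ : Euc n × Euc n} {t : ℝ}
    (hz : z0 + t • ζ ∈ Phi1 c '' (U ×ˢ V)) :
    HasDerivAt (fun s : ℝ => Bq1 c U V (z0 + s • ζ) ζ) (Bq2 c U V (z0 + t • ζ) ζ ζ) t :=
  hda_const (hda_chain (N := Bq1 c U V) (γ := fun s : ℝ => z0 + s • ζ)
    (h.hasFDerivAt_Bq1 hz) (hda_line z0 ζ t)) ζ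

/-- second derivative of the Hessian along a y-curve. -/
lemma Nice.Bq2_eval (h : Nice n c U V) {x0 p0 d : Euc n}
    (hz : (x0, p0) ∈ Phi1 c '' (U ×ˢ V)) {w b : Euc n}
    (hw : HasDerivAt (fun s : ℝ => H1 c U V ((x0, p0) + s • ((0 : Euc n), d))) ((0 : Euc n), w) 0)
    (hb : HasDerivAt (deriv (fun s : ℝ => H1 c U V ((x0, p0) + s • ((0 : Euc n), d))))
      ((0 : Euc n), b) 0) (ξ η : Euc n × Euc n) :
    Bq2 c U V (x0, p0) (0, d) (0, d) ξ η =
      K4 c (H1 c U V (x0, p0)) (0, w) (0, w) ξ η + K3 c (H1 c U V (x0, p0)) (0, b) ξ η := by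
  have hz' : (x0, p0) + (0 : ℝ) • ((0 : Euc n), d) ∈ Phi1 c '' (U ×ˢ V) := by simpa using hz
  set ζ : Euc n × Euc n := (0, d) with hζ
  set Z := fun s : ℝ => H1 c U V ((x0, p0) + s • ζ) with hZ
  have hcont : Continuous (fun s : ℝ => (x0, p0) + s • ζ) := by fun_prop
  have hopen : IsOpen ((fun s : ℝ => (x0, p0) + s • ζ) ⁻¹' (Phi1 c '' (U ×ˢ V))) :=
    h.H1_contDiff.1.preimage hcont
  have hev : ∀ᶠ t in nhds (0 : ℝ), (x0, p0) + t • ζ ∈ Phi1 c '' (U ×ˢ V) := hopen.mem_nhds hz'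
  have hd : ∀ᶠ t in nhds (0 : ℝ), HasDerivAt Z (deriv Z t) t := by
    filter_upwards [hev] with t ht
    obtain ⟨w', b', h1, -⟩ := h.ycurve x0 p0 d ht
    exact h1.differentiableAt.hasDerivAt
  have e1 : (fun s : ℝ => Bq1 c U V ((x0, p0) + s • ζ) ζ ξ η) =ᶠ[nhds 0]
      fun s => K3 c (Z s) (deriv Z s) ξ η := by
    filter_upwards [hev, hd] with t ht hdt
    have h1 := hda_const2 (h.Bq_line1 ht) ξ η
    have h2 := hda_const2 (K2_curve h.oO h.hC (Z := Z) (h.H1_spec ht).1 hdt) ξ η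
    exact h1.unique h2
  have h3 := hda_const2 (h.Bq_line2 hz') ξ η
  have hZ0 : Z 0 = H1 c U V (x0, p0) := by simp [hZ]
  have h4 := hda_app_const2 (A := fun s => K3 c (Z s)) (s := 0)
    (K3_curve h.oO h.hC (Z := Z) (s := 0) (h.H1_spec hz').1 hw) hb ξ η
  have h5 := (h3.congr_of_eventuallyEq e1.symm).unique h4
  rw [hw.deriv, hZ0] at h5
  rw [← h5]
  simp

/-- the curvature inequality, when the whole segments are admissible. -/
lemma Nice.mtw_core (h : Nice n c U V) {x0 y0 v d : Euc n} (hx : x0 ∈ U) (hy : y0 ∈ V)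
    (P : Prop)
    (hB : ∀ x y : ℝ → Euc n, (∀ t ∈ Icc (-1 : ℝ) 1, x t ∈ closure U) →
      (∀ t ∈ Icc (-1 : ℝ) 1, y t ∈ closure V) →
      IsAffineSeg n (fun t => (gradY n c (x t) (y 0), gradX n c (x 0) (y t))) →
      (P ∨ crossDiff2 n c x y = 0) → crossDiff4 n c x y ≤ 0)
    (h1 : ∀ t ∈ Icc (-1 : ℝ) 1, (x0, -gradX n c x0 y0) + t • ((0 : Euc n), d) ∈
      Phi1 c '' (U ×ˢ V))
    (h2 : ∀ t ∈ Icc (-1 : ℝ) 1, (-gradY n c x0 y0, y0) + t • (-DxyC n c x0 y0 v, (0 : Euc n)) ∈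
      Phi2 c '' (U ×ˢ V))
    (hP : P ∨ inner ℝ d v = 0) :
    Bq2 c U V (x0, -gradX n c x0 y0) (0, d) (0, d) (v, 0) (v, 0) ≤ 0 := by
  set p0 := -gradX n c x0 y0 with hp0
  set q0 := -gradY n c x0 y0 with hq0
  set e := -DxyC n c x0 y0 v with he
  have hz0 : (x0, y0) ∈ U ×ˢ V := mk_mem_prod hx hy
  have hH1 : H1 c U V (x0, p0) = (x0, y0) := h.H1_Phi hz0
  have hH2 : H2 c U V (q0, y0) = (x0, y0) := h.H2_Phi hz0
  have hmem0 : (0 : ℝ) ∈ Icc (-1 : ℝ) 1 := by constructor <;> norm_num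
  obtain ⟨w, b, hw, hb, hw1, hb1⟩ := h.ycurve x0 p0 d (h1 0 hmem0)
  obtain ⟨v', a, hv, ha, hv1, ha1⟩ := h.xcurve q0 y0 e (h2 0 hmem0)
  simp only [zero_smul, add_zero, hH1, hH2] at hw1 hb1 hv1 ha1
  have hvv : v' = v := by
    have : v' - v = 0 := by
      apply h.N1 _ hz0
      intro w'
      have e1 := hv1 w'
      have e2 : inner ℝ e w' = - K2 c (x0, y0) (v, 0) (0, w') := by
        rw [he, inner_neg_left, inner_DxyC h.oO h.hC hz0]
      rw [e2, neg_neg] at e1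
      have e3 : ((v' - v, 0) : Euc n × Euc n) = (v', 0) - (v, 0) := by simp
      rw [e3, map_sub, ContinuousLinearMap.sub_apply, e1, sub_self]
    exact sub_eq_zero.mp this
  subst hvv
  set ZY := fun s : ℝ => H1 c U V ((x0, p0) + s • ((0 : Euc n), d)) with hZY
  set ZX := fun s : ℝ => H2 c U V ((q0, y0) + s • (e, (0 : Euc n))) with hZX
  set X := fun s => (ZX s).1 with hX
  set Y := fun s => (ZY s).2 with hY
  have evY : ∀ᶠ t in nhds (0 : ℝ), t ∈ Icc (-1 : ℝ) 1 := Icc_mem_nhds (by norm_num) (by norm_num)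
  have dY : ∀ᶠ t in nhds (0:ℝ), HasDerivAt ZY (deriv ZY t) t := by
    filter_upwards [evY] with t ht
    obtain ⟨w', b', h3, -⟩ := h.ycurve x0 p0 d (h1 t ht)
    exact h3.differentiableAt.hasDerivAt
  have dX : ∀ᶠ t in nhds (0:ℝ), HasDerivAt ZX (deriv ZX t) t := by
    filter_upwards [evY] with t ht
    obtain ⟨w', b', h3, -⟩ := h.xcurve q0 y0 e (h2 t ht)
    exact h3.differentiableAt.hasDerivAt
  have hfst : ∀ {Z : ℝ → Euc n × Euc n} {z' : Euc n × Euc n} {t : ℝ}, HasDerivAt Z z' t →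
      HasDerivAt (fun s => (Z s).1) z'.1 t := fun {Z z' t} hh =>
    hda_chain (N := Prod.fst) (γ := Z) hasFDerivAt_fst hh
  have hsnd : ∀ {Z : ℝ → Euc n × Euc n} {z' : Euc n × Euc n} {t : ℝ}, HasDerivAt Z z' t →
      HasDerivAt (fun s => (Z s).2) z'.2 t := fun {Z z' t} hh =>
    hda_chain (N := Prod.snd) (γ := Z) hasFDerivAt_snd hh
  have dX' : ∀ᶠ t in nhds (0:ℝ), HasDerivAt X (deriv X t) t := by
    filter_upwards [dX] with t ht using (hfst ht).differentiableAt.hasDerivAt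
  have dY' : ∀ᶠ t in nhds (0:ℝ), HasDerivAt Y (deriv Y t) t := by
    filter_upwards [dY] with t ht using (hsnd ht).differentiableAt.hasDerivAt
  have eX : deriv X =ᶠ[nhds 0] fun t => (deriv ZX t).1 := by
    filter_upwards [dX] with t ht using (hfst ht).deriv
  have eY : deriv Y =ᶠ[nhds 0] fun t => (deriv ZY t).2 := by
    filter_upwards [dY] with t ht using (hsnd ht).deriv
  have hX0 : X 0 = x0 := by simp [hX, hZX, hH2]
  have hY0 : Y 0 = y0 := by simp [hY, hZY, hH1]
  obtain ⟨c2, c4⟩ := cross_eval (X := X) (Y := Y) (v := v') (a := a) (w := w) (b := b)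
    h.oU h.oV h.hC (by rw [hX0]; exact hx) dX' ((hfst hv).deriv)
    ((hfst ha).congr_of_eventuallyEq eX) (by rw [hY0]; exact hy) dY' ((hsnd hw).deriv)
    ((hsnd hb).congr_of_eventuallyEq eY)
  rw [hX0, hY0] at c2 c4
  have hineq := hB X Y
    (fun t ht => subset_closure (h.H2_spec (h2 t ht)).1.1)
    (fun t ht => subset_closure (h.H1_spec (h1 t ht)).1.2) (by
      refine ⟨(-q0, -p0), (-e, -d), fun t ht => ?_⟩
      obtain ⟨-, a1, a2⟩ := h.H2_spec (h2 t ht)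
      obtain ⟨-, b1, b2⟩ := h.H1_spec (h1 t ht)
      have a3 : (ZX t).2 = y0 := a1.trans (by simp)
      have b3 : (ZY t).1 = x0 := b1.trans (by simp)
      have a4 : gradY n c (X t) (Y 0) = -q0 + t • (-e) := by
        rw [hY0, ← a3]
        refine a2.trans ?_
        simp [add_comm]
      have b4 : gradX n c (X 0) (Y t) = -p0 + t • (-d) := by
        rw [hX0, ← b3]
        refine b2.trans ?_
        simp [add_comm]
      simp only [a4, b4]
      rfl) (by
      rcases hP with hP | hP
      · exact Or.inl hP
      · right
        rw [c2, K2_symm h.oO h.hC hz0, hw1, hP, neg_zero])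
  rw [c4] at hineq
  have hz0' : (x0, p0) ∈ Phi1 c '' (U ×ˢ V) := by simpa using h1 0 hmem0
  rw [h.Bq2_eval hz0' hw hb, hH1]
  have r1 := hb1 a
  rw [← K3_rot h.oO h.hC hz0] at hineq
  have s1 : K3 c (x0, y0) (0, w) (0, w) (a, 0) = K3 c (x0, y0) (a, 0) (0, w) (0, w) :=
    K3_rot h.oO h.hC hz0 _ _
  have s2 := K2_symm h.oO h.hC hz0 (0, b) (a, 0)
  have s3 := K4_swap h.oO h.hC hz0 (v', 0) (0, w)
  have s4 := K3_rot h.oO h.hC hz0 (v', 0) (0, b)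
  linarith

lemma exists_small_seg {Z : Type*} [NormedAddCommGroup Z] [NormedSpace ℝ Z] {W : Set Z}
    (hW : IsOpen W) {z : Z} (hz : z ∈ W) (ζ : Z) :
    ∃ δ > 0, ∀ r : ℝ, |r| ≤ δ → z + r • ζ ∈ W := by
  have hcont : Continuous (fun s : ℝ => z + s • ζ) := by fun_prop
  have h1 : (fun s : ℝ => z + s • ζ) ⁻¹' W ∈ nhds (0 : ℝ) :=
    (hW.preimage hcont).mem_nhds (by simpa using hz)
  obtain ⟨δ, hδ, hb⟩ := Metric.mem_nhds_iff.mp h1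
  refine ⟨δ / 2, by positivity, fun r hr => hb ?_⟩
  rw [mem_ball_zero_iff, Real.norm_eq_abs]
  linarith

lemma Nice.mtw (h : Nice n c U V) {x0 p0 v d : Euc n} (hz : (x0, p0) ∈ Phi1 c '' (U ×ˢ V))
    (P : Prop)
    (hB : ∀ x y : ℝ → Euc n, (∀ t ∈ Icc (-1 : ℝ) 1, x t ∈ closure U) →
      (∀ t ∈ Icc (-1 : ℝ) 1, y t ∈ closure V) →
      IsAffineSeg n (fun t => (gradY n c (x t) (y 0), gradX n c (x 0) (y t))) →
      (P ∨ crossDiff2 n c x y = 0) → crossDiff4 n c x y ≤ 0)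
    (hP : P ∨ inner ℝ d v = 0) :
    Bq2 c U V (x0, p0) (0, d) (0, d) (v, 0) (v, 0) ≤ 0 := by
  obtain ⟨⟨x, y⟩, hxy, he⟩ := id hz
  obtain ⟨rfl, rfl⟩ := Prod.mk.injEq .. ▸ he
  simp only at hz ⊢
  have hz2 : (-gradY n c x y, y) ∈ Phi2 c '' (U ×ˢ V) := ⟨(x, y), hxy, rfl⟩
  obtain ⟨δ1, h1, h1'⟩ := exists_small_seg h.H1_contDiff.1 hz ((0 : Euc n), d)
  obtain ⟨δ2, h2, h2'⟩ := exists_small_seg h.H2_contDiff.1 hz2 (-DxyC n c x y v, (0 : Euc n))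
  set ε := min δ1 δ2 with hε
  have hε0 : 0 < ε := lt_min h1 h2
  have habs : ∀ t ∈ Icc (-1 : ℝ) 1, |t * ε| ≤ ε := by
    intro t ht
    rw [abs_mul, abs_of_pos hε0]
    have := abs_le.mpr ht
    nlinarith
  have key := h.mtw_core (v := ε • v) (d := ε • d) hxy.1 hxy.2 P hB
    (fun t ht => by
      have := h1' (t * ε) ((habs t ht).trans (min_le_left _ _))
      rw [mul_smul] at this
      simpa using this)
    (fun t ht => by
      have := h2' (t * ε) ((habs t ht).trans (min_le_right _ _))
      rw [mul_smul] at this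
      simpa using this)
    (hP.imp id (fun hp => by rw [inner_smul_left, inner_smul_right, hp]; simp))
  have e1 : ((0 : Euc n), ε • d) = ε • ((0 : Euc n), d) := by simp
  have e2 : (ε • v, (0 : Euc n)) = ε • (v, (0 : Euc n)) := by simp
  rw [e1, e2] at key
  simp only [map_smul, ContinuousLinearMap.smul_apply, smul_eq_mul] at key
  have : ε * (ε * (ε * (ε * Bq2 c U V (x, -gradX n c x y) (0, d) (0, d) (v, 0) (v, 0)))) ≤ 0 := by
    exact key
  by_contra hcon
  push Not at hcon
  have : 0 < ε * (ε * (ε * (ε * Bq2 c U V (x, -gradX n c x y) (0, d) (0, d) (v, 0) (v, 0)))) := by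
    positivity
  linarith

end Mtw2

section OneDim

lemma hda_lin (K t : ℝ) : HasDerivAt (fun t : ℝ => K * t) K t := by
  simpa using (hasDerivAt_id t).const_mul K

lemma mono_of_hda {f f' : ℝ → ℝ} {a b : ℝ}
    (h : ∀ t ∈ Icc a b, HasDerivAt f (f' t) t) (h0 : ∀ t ∈ Icc a b, 0 ≤ f' t) :
    MonotoneOn f (Icc a b) := by
  refine monotoneOn_of_deriv_nonneg (convex_Icc a b)
    (fun t ht => (h t ht).continuousAt.continuousWithinAt)
    (fun t ht => ((h t (interior_subset ht)).differentiableAt).differentiableWithinAt) ?_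
  intro t ht
  rw [(h t (interior_subset ht)).deriv]
  exact h0 t (interior_subset ht)

lemma convex_ineq_of_hda {f f1 f2 : ℝ → ℝ}
    (h1 : ∀ t ∈ Icc (0 : ℝ) 1, HasDerivAt f (f1 t) t)
    (h2 : ∀ t ∈ Icc (0 : ℝ) 1, HasDerivAt f1 (f2 t) t) (h0 : ∀ t ∈ Icc (0 : ℝ) 1, 0 ≤ f2 t)
    {s : ℝ} (hs : s ∈ Icc (0 : ℝ) 1) : f s ≤ (1 - s) * f 0 + s * f 1 := by
  have hc : ConvexOn ℝ (Icc (0 : ℝ) 1) f := by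
    refine convexOn_of_hasDerivWithinAt2_nonneg (f' := f1) (f'' := f2) (convex_Icc 0 1)
      (fun t ht => (h1 t ht).continuousAt.continuousWithinAt) ?_ ?_ ?_
    · intro t ht; exact (h1 t (interior_subset ht)).hasDerivWithinAt
    · intro t ht; exact (h2 t (interior_subset ht)).hasDerivWithinAt
    · intro t ht; exact h0 t (interior_subset ht)
  have := hc.2 (left_mem_Icc.mpr zero_le_one) (right_mem_Icc.mpr zero_le_one)
    (sub_nonneg.mpr hs.2) hs.1 (sub_add_cancel 1 s)
  simpa using this

lemma taylor_lower {f f1 f2 : ℝ → ℝ} {K : ℝ} (hK : 0 ≤ K)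
    (h1 : ∀ t ∈ Icc (0 : ℝ) 1, HasDerivAt f (f1 t) t)
    (h2 : ∀ t ∈ Icc (0 : ℝ) 1, HasDerivAt f1 (f2 t) t)
    (h0 : ∀ t ∈ Icc (0 : ℝ) 1, -K ≤ f2 t) : -K ≤ f 1 - f 0 - f1 0 := by
  have hz : (0 : ℝ) ∈ Icc (0 : ℝ) 1 := left_mem_Icc.mpr zero_le_one
  have ho : (1 : ℝ) ∈ Icc (0 : ℝ) 1 := right_mem_Icc.mpr zero_le_one
  have m1 : MonotoneOn (fun t => f1 t + K * t) (Icc 0 1) := by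
    refine mono_of_hda (f' := fun t => f2 t + K) (fun t ht => ?_) (fun t ht => ?_)
    · exact (h2 t ht).add (hda_lin K t)
    · linarith [h0 t ht]
  have m2 : MonotoneOn (fun t => f t - f1 0 * t + K * t) (Icc 0 1) := by
    refine mono_of_hda (f' := fun t => f1 t - f1 0 + K) (fun t ht => ?_) (fun t ht => ?_)
    · exact ((h1 t ht).sub (hda_lin (f1 0) t)).add (hda_lin K t)
    · have := m1 hz ht ht.1
      simp only [mul_zero, add_zero] at this
      nlinarith [ht.2]
  have := m2 hz ho zero_le_one
  simp only [mul_zero, add_zero, sub_zero, mul_one] at this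
  linarith

lemma quasi_of_hda {f f1 f2 : ℝ → ℝ} {C : ℝ}
    (h1 : ∀ t ∈ Icc (0 : ℝ) 1, HasDerivAt f (f1 t) t)
    (h2 : ∀ t ∈ Icc (0 : ℝ) 1, HasDerivAt f1 (f2 t) t)
    (h0 : ∀ t ∈ Icc (0 : ℝ) 1, -(C * |f1 t|) ≤ f2 t)
    {s : ℝ} (hs : s ∈ Icc (0 : ℝ) 1) : f s ≤ max (f 0) (f 1) := by
  have claim : ∀ a b : ℝ, 0 ≤ a → a ≤ b → b ≤ 1 → 0 ≤ f1 a → 0 ≤ f1 b := by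
    intro a b ha hab hb hfa
    by_contra hcon
    push Not at hcon
    have hsub : Icc a b ⊆ Icc (0 : ℝ) 1 := Icc_subset_Icc ha hb
    have hcont : ContinuousOn f1 (Icc a b) := fun t ht =>
      (h2 t (hsub ht)).continuousAt.continuousWithinAt
    have hcl : IsCompact (Icc a b ∩ f1 ⁻¹' Ici 0) :=
      isCompact_Icc.of_isClosed_subset (hcont.preimage_isClosed_of_isClosed isClosed_Icc isClosed_Ici)
        inter_subset_left
    obtain ⟨a', ⟨ha'1, ha'2⟩, hgr⟩ := hcl.exists_isGreatest ⟨a, left_mem_Icc.mpr hab, hfa⟩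
    have hneg : ∀ t ∈ Icc a' b, f1 t ≤ 0 ∨ t = a' := by
      intro t ht
      by_contra hc
      push Not at hc
      exact hc.2 (le_antisymm (hgr ⟨⟨ha'1.1.trans ht.1, ht.2⟩, hc.1.le⟩) ht.1)
    have hz : f1 a' = 0 := by
      refine le_antisymm ?_ ha'2
      by_contra hc
      push Not at hc
      have hab' : a' ≤ b := ha'1.2
      have : (0 : ℝ) ∈ f1 '' Icc a' b := intermediate_value_Icc' hab'
        (hcont.mono (Icc_subset_Icc ha'1.1 le_rfl)) ⟨hcon.le, hc.le⟩
      obtain ⟨t, ht, ht0⟩ := this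
      have e := hgr ⟨⟨ha'1.1.trans ht.1, ht.2⟩, by simp [ht0]⟩
      have : t = a' := le_antisymm e ht.1
      rw [this] at ht0
      linarith
    have hm : MonotoneOn (fun t => Real.exp (-C * t) * f1 t) (Icc a' b) := by
      refine mono_of_hda
        (f' := fun t => Real.exp (-C * t) * (-C) * f1 t + Real.exp (-C * t) * f2 t)
        (fun t ht => ?_) (fun t ht => ?_)
      · have e1 : HasDerivAt (fun t : ℝ => Real.exp (-C * t)) (Real.exp (-C * t) * (-C)) t := by
          have := ((hasDerivAt_id t).const_mul (-C)).exp
          simpa using this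
        exact e1.mul (h2 t (hsub ⟨ha'1.1.trans ht.1, ht.2⟩))
      · have hle : f1 t ≤ 0 := by
          rcases hneg t ht with h | h
          · exact h
          · rw [h, hz]
        have := h0 t (hsub ⟨ha'1.1.trans ht.1, ht.2⟩)
        rw [abs_of_nonpos hle] at this
        have hp := Real.exp_pos (-C * t)
        have : 0 ≤ f2 t - C * f1 t := by linarith
        nlinarith [mul_nonneg hp.le this]
    have := hm (left_mem_Icc.mpr ha'1.2) (right_mem_Icc.mpr ha'1.2) ha'1.2
    simp only [hz, mul_zero] at this
    have hp := Real.exp_pos (-C * b)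
    nlinarith
  by_cases hle : f s ≤ f 0
  · exact hle.trans (le_max_left _ _)
  push Not at hle
  have hs0 : 0 < s := by
    rcases hs.1.lt_or_eq with h | h
    · exact h
    · rw [← h] at hle; exact absurd hle (lt_irrefl _)
  obtain ⟨a, ha, hda⟩ := exists_hasDerivAt_eq_slope f f1 hs0
    (fun t ht => (h1 t ⟨ht.1, ht.2.trans hs.2⟩).continuousAt.continuousWithinAt)
    (fun t ht => h1 t ⟨ht.1.le, ht.2.le.trans hs.2⟩)
  have hfa : 0 ≤ f1 a := by
    rw [hda]
    apply div_nonneg <;> linarith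
  have hm : MonotoneOn f (Icc a 1) :=
    mono_of_hda (fun t ht => h1 t ⟨ha.1.le.trans ht.1, ht.2⟩)
      (fun t ht => claim a t ha.1.le ht.1 ht.2 hfa)
  exact (hm ⟨ha.2.le, hs.2⟩ (right_mem_Icc.mpr (ha.2.le.trans hs.2)) hs.2).trans (le_max_right _ _)

end OneDim

section Polar

lemma polar_bound {n : ℕ} (T : Euc n × Euc n →L[ℝ] Euc n × Euc n →L[ℝ] ℝ) {d v : Euc n} {C : ℝ}
    (hC : ‖T‖ ≤ C * ‖d‖ ^ 2)
    (hT : ∀ v', inner ℝ d v' = 0 → T (v', 0) (v', 0) ≤ 0) :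
    T (v, 0) (v, 0) ≤ 2 * C * ‖d‖ * ‖v‖ * |inner ℝ d v| := by
  by_cases hd : d = 0
  · subst hd
    have := hT v (by simp)
    simpa using this
  have hd' : 0 < ‖d‖ := norm_pos_iff.mpr hd
  set l := inner ℝ d v / ‖d‖ ^ 2 with hl
  set v' := v - l • d with hv'
  have ho : inner ℝ d v' = 0 := by
    rw [hv', inner_sub_right, inner_smul_right, real_inner_self_eq_norm_sq, hl]
    field_simp
    ring
  have h1 := hT v' ho
  have hn : ‖v'‖ ≤ ‖v‖ := by
    have e : v = v' + l • d := by simp [hv']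
    have e2 : ‖v‖ ^ 2 = ‖v'‖ ^ 2 + ‖l • d‖ ^ 2 := by
      rw [e, norm_add_sq_real, inner_smul_right, real_inner_comm, ho]; ring
    have : ‖v'‖ ^ 2 ≤ ‖v‖ ^ 2 := by nlinarith [sq_nonneg ‖l • d‖]
    exact (sq_le_sq₀ (norm_nonneg _) (norm_nonneg _)).mp this
  have hT2 : ∀ a b : Euc n, |T (a, 0) (b, 0)| ≤ C * ‖d‖ ^ 2 * ‖a‖ * ‖b‖ := by
    intro a b
    have e1 := T.le_opNorm₂ (a, 0) (b, 0)
    have e2 : ‖((a, 0) : Euc n × Euc n)‖ = ‖a‖ := by simp [Prod.norm_def]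
    have e3 : ‖((b, 0) : Euc n × Euc n)‖ = ‖b‖ := by simp [Prod.norm_def]
    rw [e2, e3, Real.norm_eq_abs] at e1
    refine e1.trans ?_
    gcongr
  have hsplit : T (v, 0) (v, 0) = T (v', 0) (v', 0) + l * T (v', 0) (d, 0) + l * T (d, 0) (v, 0) := by
    have e : ((v, 0) : Euc n × Euc n) = (v', 0) + l • (d, 0) := by simp [hv']
    have e4 : T (v, 0) (v, 0) = T (v', 0) (v, 0) + l * T (d, 0) (v, 0) := by
      conv_lhs => rw [show T (v, 0) = T ((v', 0) + l • (d, 0)) by rw [← e]]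
      simp only [map_add, map_smul, ContinuousLinearMap.add_apply, ContinuousLinearMap.smul_apply,
        smul_eq_mul]
    have e5 : T (v', 0) (v, 0) = T (v', 0) (v', 0) + l * T (v', 0) (d, 0) := by
      conv_lhs => rw [e]
      simp only [map_add, map_smul, smul_eq_mul]
    rw [e4, e5]
  have hC0 : 0 ≤ C * ‖d‖ ^ 2 := (norm_nonneg T).trans hC
  have b1 : l * T (v', 0) (d, 0) ≤ |l| * (C * ‖d‖ ^ 2 * ‖v‖ * ‖d‖) := by
    refine (le_abs_self _).trans ?_
    rw [abs_mul]
    gcongr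
    refine (hT2 v' d).trans ?_
    gcongr
  have b2 : l * T (d, 0) (v, 0) ≤ |l| * (C * ‖d‖ ^ 2 * ‖d‖ * ‖v‖) := by
    refine (le_abs_self _).trans ?_
    rw [abs_mul]
    gcongr
    exact hT2 d v
  have hl' : |l| * ‖d‖ ^ 2 = |inner ℝ d v| := by
    rw [hl, abs_div, abs_of_pos (by positivity : 0 < ‖d‖ ^ 2)]
    field_simp
  rw [hsplit, ← hl']
  nlinarith

end Polar

section Interior2

set_option maxSynthPendingDepth 4

variable {n : ℕ} {c : Euc n → Euc n → ℝ} {U V : Set (Euc n)}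

lemma Nice.K1_eq (h : Nice n c U V) {x y : Euc n} (hx : x ∈ U) (hy : y ∈ V) (v : Euc n) :
    K1 c (x, y) (v, 0) = inner ℝ (gradX n c x y) v := by
  rw [gradX_eq h.oO h.hC (mk_mem_prod hx hy), inner_Q1]

/-- The c-segment with respect to `y0` from `x0` to `x1`. -/
lemma Nice.cseg (h : Nice n c U V) {x0 x1 y0 : Euc n} (hx0 : x0 ∈ U) (hx1 : x1 ∈ U) (hy0 : y0 ∈ V) :
    ∃ X X1 X2 : ℝ → Euc n, X 0 = x0 ∧ X 1 = x1 ∧ ∀ s ∈ Icc (0 : ℝ) 1, X s ∈ U ∧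
      -gradY n c (X s) y0 = -gradY n c x0 y0 + s • (-gradY n c x1 y0 - -gradY n c x0 y0) ∧
      HasDerivAt X (X1 s) s ∧ HasDerivAt X1 (X2 s) s ∧
      (∀ w, K2 c (X s, y0) (X1 s, 0) (0, w) =
        - inner ℝ (-gradY n c x1 y0 - -gradY n c x0 y0) w) ∧
      (∀ w, K3 c (X s, y0) (X1 s, 0) (X1 s, 0) (0, w) + K2 c (X s, y0) (X2 s, 0) (0, w) = 0) := by
  set q0 := -gradY n c x0 y0 with hq0
  set q1 := -gradY n c x1 y0 with hq1
  set e := q1 - q0 with he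
  set Z := fun s : ℝ => H2 c U V ((q0, y0) + s • (e, (0 : Euc n))) with hZ
  have hz : ∀ s ∈ Icc (0 : ℝ) 1, (q0, y0) + s • (e, (0 : Euc n)) ∈ Phi2 c '' (U ×ˢ V) := by
    intro s hs
    have := (h.convX y0 hy0).add_smul_sub_mem ⟨x0, hx0, rfl⟩ ⟨x1, hx1, rfl⟩ hs
    obtain ⟨x, hx, hxe⟩ := this
    refine ⟨(x, y0), mk_mem_prod hx hy0, ?_⟩
    simp only [Phi2, Prod.smul_mk, smul_zero, Prod.mk_add_mk, add_zero, Prod.mk.injEq, and_true]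
    exact hxe
  have hfst : ∀ {Z : ℝ → Euc n × Euc n} {z' : Euc n × Euc n} {t : ℝ}, HasDerivAt Z z' t →
      HasDerivAt (fun s => (Z s).1) z'.1 t := fun {Z z' t} hh =>
    hda_chain (N := Prod.fst) (γ := Z) hasFDerivAt_fst hh
  refine ⟨fun s => (Z s).1, fun s => (deriv Z s).1, fun s => (deriv (deriv Z) s).1, ?_, ?_, ?_⟩
  · have : Z 0 = (x0, y0) := by
      have := h.H2_Phi (mk_mem_prod hx0 hy0)
      simp only [hZ, zero_smul, add_zero]
      exact this
    simp only [this]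
  · have : Z 1 = (x1, y0) := by
      have := h.H2_Phi (mk_mem_prod hx1 hy0)
      simp only [hZ, one_smul, he, Prod.mk_add_mk, add_zero, add_sub_cancel]
      exact this
    simp only [this]
  · intro s hs
    obtain ⟨a0, a1, a2⟩ := h.H2_spec (hz s hs)
    obtain ⟨w, b, hw, hb, hw1, hb1⟩ := h.xcurve q0 y0 e (hz s hs)
    have e2 : (Z s).2 = y0 := a1.trans (by simp)
    have eZ : Z s = ((Z s).1, y0) := Prod.ext rfl e2
    have dZ : deriv Z s = (w, 0) := hw.deriv
    have ddZ : deriv (deriv Z) s = (b, 0) := hb.deriv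
    refine ⟨a0.1, ?_, ?_, ?_, ?_, ?_⟩
    · have : gradY n c (Z s).1 y0 = -((q0, y0) + s • (e, (0 : Euc n))).1 := by
        rw [← e2]; exact a2
      rw [this]; simp
    · beta_reduce; rw [dZ]; exact hfst hw
    · beta_reduce; rw [ddZ]; exact hfst hb
    · intro w'; beta_reduce; rw [dZ, ← eZ]; exact hw1 w'
    · intro w'; beta_reduce; rw [dZ, ddZ, ← eZ]; exact hb1 w'

/-- Derivatives of the cost difference along a c-segment. -/
lemma Nice.phi_hda (h : Nice n c U V) {X X1 : ℝ → Euc n} {a y0 y1 : Euc n} {s : ℝ}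
    (hy0 : y0 ∈ V) (hy1 : y1 ∈ V) (hX : X s ∈ U) (h1 : HasDerivAt X (X1 s) s)
    (h2 : HasDerivAt X1 a s) :
    HasDerivAt (fun s => -c (X s) y1 + c (X s) y0)
      (-K1 c (X s, y1) (X1 s, 0) + K1 c (X s, y0) (X1 s, 0)) s ∧
    HasDerivAt (fun s => -K1 c (X s, y1) (X1 s, 0) + K1 c (X s, y0) (X1 s, 0))
      (-(K2 c (X s, y1) (X1 s, 0) (X1 s, 0) + K1 c (X s, y1) (a, 0)) +
        (K2 c (X s, y0) (X1 s, 0) (X1 s, 0) + K1 c (X s, y0) (a, 0))) s := by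
  have key : ∀ y ∈ V, HasDerivAt (fun s => c (X s) y) (K1 c (X s, y) (X1 s, 0)) s ∧
      HasDerivAt (fun s => K1 c (X s, y) (X1 s, 0))
        (K2 c (X s, y) (X1 s, 0) (X1 s, 0) + K1 c (X s, y) (a, 0)) s := by
    intro y hy
    have hZ := hda_pair_l h1 y
    refine ⟨K0_curve h.oO h.hC (Z := fun s => (X s, y)) (mk_mem_prod hX hy) hZ, ?_⟩
    exact hda_app (A := fun s => K1 c (X s, y)) (s := s)
      (K1_curve h.oO h.hC (Z := fun s => (X s, y)) (s := s) (mk_mem_prod hX hy) hZ)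
      (hda_pair_l h2 (0 : Euc n))
  exact ⟨(key y1 hy1).1.neg.add (key y0 hy0).1, (key y1 hy1).2.neg.add (key y0 hy0).2⟩

lemma Nice.seg_mem (h : Nice n c U V) {x y0 y1 : Euc n} (hx : x ∈ U) (hy0 : y0 ∈ V) (hy1 : y1 ∈ V)
    {t : ℝ} (ht : t ∈ Icc (0 : ℝ) 1) :
    (x, -gradX n c x y0) + t • ((0 : Euc n), -gradX n c x y1 - -gradX n c x y0) ∈
      Phi1 c '' (U ×ˢ V) := by
  have := (h.convY x hx).add_smul_sub_mem ⟨y0, hy0, rfl⟩ ⟨y1, hy1, rfl⟩ ht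
  obtain ⟨y, hy, hye⟩ := this
  refine ⟨(x, y), mk_mem_prod hx hy, ?_⟩
  simp only [Phi1, Prod.smul_mk, smul_zero, Prod.mk_add_mk, add_zero, Prod.mk.injEq, true_and]
  exact hye

/-- Lower bound on the second derivative through the curvature. -/
lemma Nice.phi2_lower (h : Nice n c U V) {x y0 y1 v a : Euc n} (hx : x ∈ U) (hy0 : y0 ∈ V)
    (hy1 : y1 ∈ V)
    (hva : ∀ w, K3 c (x, y0) (v, 0) (v, 0) (0, w) + K2 c (x, y0) (a, 0) (0, w) = 0)
    {K : ℝ} (hK : 0 ≤ K)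
    (hb : ∀ t ∈ Icc (0 : ℝ) 1,
      Bq2 c U V ((x, -gradX n c x y0) + t • ((0 : Euc n), -gradX n c x y1 - -gradX n c x y0))
        (0, -gradX n c x y1 - -gradX n c x y0) (0, -gradX n c x y1 - -gradX n c x y0)
        (v, 0) (v, 0) ≤ K) :
    -K ≤ -(K2 c (x, y1) (v, 0) (v, 0) + K1 c (x, y1) (a, 0)) +
        (K2 c (x, y0) (v, 0) (v, 0) + K1 c (x, y0) (a, 0)) := by
  set p0 := -gradX n c x y0 with hp0
  set p1 := -gradX n c x y1 with hp1
  set d := p1 - p0 with hd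
  have hmem : ∀ t ∈ Icc (0 : ℝ) 1, (x, p0) + t • ((0 : Euc n), d) ∈ Phi1 c '' (U ×ˢ V) :=
    fun t ht => h.seg_mem hx hy0 hy1 ht
  have h0m : (0 : ℝ) ∈ Icc (0 : ℝ) 1 := left_mem_Icc.mpr zero_le_one
  have hz0 : (x, y0) ∈ U ×ˢ V := mk_mem_prod hx hy0
  have hH0 : H1 c U V (x, p0) = (x, y0) := h.H1_Phi hz0
  have hH1 : H1 c U V (x, p1) = (x, y1) := h.H1_Phi (mk_mem_prod hx hy1)
  have key := taylor_lower (K := K)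
    (f := fun t : ℝ => -Bq c U V ((x, p0) + t • ((0 : Euc n), d)) (v, 0) (v, 0))
    (f1 := fun t : ℝ => -Bq1 c U V ((x, p0) + t • ((0 : Euc n), d)) (0, d) (v, 0) (v, 0))
    (f2 := fun t : ℝ => -Bq2 c U V ((x, p0) + t • ((0 : Euc n), d)) (0, d) (0, d) (v, 0) (v, 0))
    hK (fun t ht => (hda_const2 (h.Bq_line1 (hmem t ht)) (v, 0) (v, 0)).neg)
    (fun t ht => (hda_const2 (h.Bq_line2 (hmem t ht)) (v, 0) (v, 0)).neg)
    (fun t ht => neg_le_neg (hb t ht))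
  obtain ⟨w, b, hw, -, hw1, -⟩ := h.ycurve x p0 d (hmem 0 h0m)
  have e0 : Bq1 c U V ((x, p0) + (0 : ℝ) • ((0 : Euc n), d)) (0, d) (v, 0) (v, 0) =
      K3 c (x, y0) (0, w) (v, 0) (v, 0) := by
    have a1 := hda_const2 (h.Bq_line1 (hmem 0 h0m)) (v, 0) (v, 0)
    have a2 := hda_const2 (K2_curve h.oO h.hC
      (Z := fun s : ℝ => H1 c U V ((x, p0) + s • ((0 : Euc n), d))) (s := 0)
      (h.H1_spec (hmem 0 h0m)).1 hw) (v, 0) (v, 0)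
    have a3 := a1.unique a2
    rw [a3]
    simp [hH0]
  have e1 : Bq c U V ((x, p0) + (1 : ℝ) • ((0 : Euc n), d)) = K2 c (x, y1) := by
    have : (x, p0) + (1 : ℝ) • ((0 : Euc n), d) = (x, p1) := by simp [hd]
    rw [this, Bq, hH1]
  have e2 : Bq c U V ((x, p0) + (0 : ℝ) • ((0 : Euc n), d)) = K2 c (x, y0) := by
    have : (x, p0) + (0 : ℝ) • ((0 : Euc n), d) = (x, p0) := by simp
    rw [this, Bq, hH0]
  simp only [e0, e1, e2] at key
  simp only [zero_smul, add_zero, hH0] at hw1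
  have r1 := hva w
  have r2 := hw1 a
  have r3 := K3_rot h.oO h.hC hz0 (v, 0) (0, w)
  have r4 := K2_symm h.oO h.hC hz0 (0, w) (a, 0)
  have r5 := h.K1_eq hx hy0 a
  have r6 := h.K1_eq hx hy1 a
  have r7 : inner ℝ d a = -inner ℝ (gradX n c x y1) a + inner ℝ (gradX n c x y0) a := by
    rw [hd, hp0, hp1]; simp [inner_add_left, inner_neg_left]
  linarith

/-- (B4): convexity along c-segments, interior version. -/
lemma Nice.ineq_convex (h : Nice n c U V) (hB4 : B4cond n c U V) {x0 x1 x y0 y1 : Euc n}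
    (hx0 : x0 ∈ U) (hx1 : x1 ∈ U) (hx : x ∈ U) (hy0 : y0 ∈ V) (hy1 : y1 ∈ V) {s : ℝ}
    (hs : s ∈ Icc (0 : ℝ) 1)
    (he : -gradY n c x y0 = -gradY n c x0 y0 + s • (-gradY n c x1 y0 - -gradY n c x0 y0)) :
    -c x y1 + c x y0 ≤ (1 - s) * (-c x0 y1 + c x0 y0) + s * (-c x1 y1 + c x1 y0) := by
  obtain ⟨X, X1, X2, hX0, hX1, hX⟩ := h.cseg hx0 hx1 hy0
  have hxs : X s = x := h.injX y0 hy0 (hX s hs).1 hx ((hX s hs).2.1.trans he.symm)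
  have := convex_ineq_of_hda (f := fun s => -c (X s) y1 + c (X s) y0)
    (fun t ht => (h.phi_hda hy0 hy1 (hX t ht).1 (hX t ht).2.2.1 (hX t ht).2.2.2.1).1)
    (fun t ht => (h.phi_hda hy0 hy1 (hX t ht).1 (hX t ht).2.2.1 (hX t ht).2.2.2.1).2)
    (fun t ht => by
      have := h.phi2_lower (K := 0) (hX t ht).1 hy0 hy1 (hX t ht).2.2.2.2.2 le_rfl
        (fun r hr => by
          have hm := h.seg_mem (hX t ht).1 hy0 hy1 hr
          have e : (X t, -gradX n c (X t) y0) +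
            r • ((0 : Euc n), -gradX n c (X t) y1 - -gradX n c (X t) y0) =
            (X t, -gradX n c (X t) y0 + r • (-gradX n c (X t) y1 - -gradX n c (X t) y0)) := by simp
          rw [e] at hm ⊢
          exact h.mtw hm True (fun x y a1 a2 a3 _ => hB4 x y a1 a2 a3) (Or.inl trivial))
      simpa using this) hs
  simpa only [hX0, hX1, hxs] using this

/-- (B3): quasi-convexity along c-segments, interior version. -/
lemma Nice.ineq_quasi (h : Nice n c U V) (hB3 : B3cond n c U V) {x0 x1 x y0 y1 : Euc n}
    (hx0 : x0 ∈ U) (hx1 : x1 ∈ U) (hx : x ∈ U) (hy0 : y0 ∈ V) (hy1 : y1 ∈ V) {s : ℝ}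
    (hs : s ∈ Icc (0 : ℝ) 1)
    (he : -gradY n c x y0 = -gradY n c x0 y0 + s • (-gradY n c x1 y0 - -gradY n c x0 y0)) :
    -c x y1 + c x y0 ≤ max (-c x0 y1 + c x0 y0) (-c x1 y1 + c x1 y0) := by
  obtain ⟨X, X1, X2, hX0, hX1, hX⟩ := h.cseg hx0 hx1 hy0
  have hxs : X s = x := h.injX y0 hy0 (hX s hs).1 hx ((hX s hs).2.1.trans he.symm)
  have cX : ContinuousOn X (Icc (0 : ℝ) 1) := fun t ht =>
    (hX t ht).2.2.1.continuousAt.continuousWithinAt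
  have cX1 : ContinuousOn X1 (Icc (0 : ℝ) 1) := fun t ht =>
    (hX t ht).2.2.2.1.continuousAt.continuousWithinAt
  have cg : ∀ y ∈ V, ContinuousOn (fun t => gradX n c (X t) y) (Icc (0 : ℝ) 1) := by
    intro y hy
    have : ContinuousOn (fun t => Q1 n (K1 c (X t, y))) (Icc (0 : ℝ) 1) :=
      (Q1 n).continuous.comp_continuousOn ((contDiffOn_K1 h.oO h.hC).continuousOn.comp
        (cX.prodMk continuousOn_const) (fun t ht => mk_mem_prod (hX t ht).1 hy))
    exact this.congr (fun t ht => gradX_eq h.oO h.hC (mk_mem_prod (hX t ht).1 hy))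
  set D := fun t => -gradX n c (X t) y1 - -gradX n c (X t) y0 with hD
  have cD : ContinuousOn D (Icc (0 : ℝ) 1) := (cg y1 hy1).neg.sub (cg y0 hy0).neg
  set I2 := Icc (0 : ℝ) 1 ×ˢ Icc (0 : ℝ) 1 with hI2
  have m1 : MapsTo (Prod.fst : ℝ × ℝ → ℝ) I2 (Icc (0 : ℝ) 1) := fun z hz => hz.1
  have cB : ContinuousOn (fun z : ℝ × ℝ => Bq2 c U V ((X z.1, -gradX n c (X z.1) y0) +
      z.2 • ((0 : Euc n), D z.1))) I2 := by
    refine h.Bq2_cont.comp ?_ (fun z hz => h.seg_mem (hX z.1 hz.1).1 hy0 hy1 hz.2)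
    have c1 := cX.comp continuousOn_fst m1
    have c2 := (cg y0 hy0).neg.comp continuousOn_fst m1
    have c3 := cD.comp continuousOn_fst m1
    exact (c1.prodMk c2).add (continuousOn_snd.smul (continuousOn_const.prodMk c3))
  have cF : ContinuousOn (fun z : ℝ × ℝ => 2 * ‖Bq2 c U V ((X z.1, -gradX n c (X z.1) y0) +
      z.2 • ((0 : Euc n), D z.1))‖ * ‖D z.1‖ * ‖X1 z.1‖) I2 :=
    ((continuousOn_const.mul cB.norm).mul (cD.comp continuousOn_fst m1).norm).mul
      (cX1.comp continuousOn_fst m1).norm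
  obtain ⟨C, hC⟩ := (isCompact_Icc.prod isCompact_Icc).exists_bound_of_continuousOn cF
  have hCb : ∀ s ∈ Icc (0 : ℝ) 1, ∀ t ∈ Icc (0 : ℝ) 1,
      2 * ‖Bq2 c U V ((X s, -gradX n c (X s) y0) + t • ((0 : Euc n), D s))‖ * ‖D s‖ * ‖X1 s‖ ≤ C :=
    fun s hs t ht => (le_abs_self _).trans (hC (s, t) ⟨hs, ht⟩)
  have hC0 : 0 ≤ C := by
    refine le_trans ?_ (hCb 0 (left_mem_Icc.mpr zero_le_one) 0 (left_mem_Icc.mpr zero_le_one))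
    positivity
  have := quasi_of_hda (f := fun s => -c (X s) y1 + c (X s) y0) (C := C)
    (fun t ht => (h.phi_hda hy0 hy1 (hX t ht).1 (hX t ht).2.2.1 (hX t ht).2.2.2.1).1)
    (fun t ht => (h.phi_hda hy0 hy1 (hX t ht).1 (hX t ht).2.2.1 (hX t ht).2.2.2.1).2)
    (fun t ht => by
      have hXt := (hX t ht).1
      have hin : -K1 c (X t, y1) (X1 t, 0) + K1 c (X t, y0) (X1 t, 0) = inner ℝ (D t) (X1 t) := by
        rw [h.K1_eq hXt hy0, h.K1_eq hXt hy1]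
        simp [hD, inner_add_left, inner_neg_left]
      rw [hin]
      refine h.phi2_lower hXt hy0 hy1 (hX t ht).2.2.2.2.2 (by positivity)
        (fun r hr => ?_)
      have hm := h.seg_mem hXt hy0 hy1 hr
      have e : (X t, -gradX n c (X t) y0) + r • ((0 : Euc n), D t) =
        (X t, -gradX n c (X t) y0 + r • D t) := by simp
      have hcb := hCb t ht r hr
      change Bq2 c U V ((X t, -gradX n c (X t) y0) + r • ((0 : Euc n), D t)) (0, D t) (0, D t)
        (X1 t, 0) (X1 t, 0) ≤ _
      have hm' : (X t, -gradX n c (X t) y0) + r • ((0 : Euc n), D t) ∈ Phi1 c '' (U ×ˢ V) := hm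
      rw [e] at hm' hcb ⊢
      set B := Bq2 c U V (X t, -gradX n c (X t) y0 + r • D t) with hBdef
      have hnorm : ‖B (0, D t) (0, D t)‖ ≤ ‖B‖ * ‖D t‖ ^ 2 := by
        have := B.le_opNorm₂ (0, D t) (0, D t)
        have e2 : ‖((0, D t) : Euc n × Euc n)‖ = ‖D t‖ := by simp [Prod.norm_def]
        rw [e2] at this
        linarith
      have := polar_bound (v := X1 t) (B (0, D t) (0, D t)) hnorm (fun v' hv' =>
        h.mtw hm' False (fun x y a1 a2 a3 a4 => hB3 x y a1 a2 a3 (a4.resolve_left id))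
          (Or.inr hv'))
      exact this.trans (mul_le_mul_of_nonneg_right hcb (abs_nonneg _))) hs
  simpa only [hX0, hX1, hxs] using this

lemma Nice.phi2_bound (h : Nice n c U V) {β A G T : ℝ}
    (hβ : ∀ z ∈ U ×ˢ V, ‖(DxyC n c z.1 z.2).inverse‖ ≤ β)
    (hA : ∀ z ∈ U ×ˢ V, ‖DxxC n c z.1 z.2‖ ≤ A)
    (hG : ∀ z ∈ U ×ˢ V, ‖gradX n c z.1 z.2‖ ≤ G)
    (hT : ∀ z ∈ U ×ˢ V, ‖DxxyC n c z.1 z.2‖ ≤ T) {x y0 y1 v a e : Euc n}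
    (hXt : x ∈ U) (hy0 : y0 ∈ V) (hy1 : y1 ∈ V)
    (r1 : ∀ w, K2 c (x, y0) (v, 0) (0, w) = - inner ℝ e w)
    (r2 : ∀ w, K3 c (x, y0) (v, 0) (v, 0) (0, w) + K2 c (x, y0) (a, 0) (0, w) = 0) :
    -(2 * (β ^ 2 * A + β ^ 3 * G * T) * ‖e‖ ^ 2) ≤
      -(K2 c (x, y1) (v, 0) (v, 0) + K1 c (x, y1) (a, 0)) +
        (K2 c (x, y0) (v, 0) (v, 0) + K1 c (x, y0) (a, 0)) := by
  have hz0 := mk_mem_prod hXt hy0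
  have hβ0 : 0 ≤ β := (norm_nonneg _).trans (hβ (x, y0) hz0)
  have hA0 : 0 ≤ A := (norm_nonneg _).trans (hA (x, y0) hz0)
  have hG0 : 0 ≤ G := (norm_nonneg _).trans (hG (x, y0) hz0)
  have hT0 : 0 ≤ T := (norm_nonneg _).trans (hT (x, y0) hz0)
  have d1 : DxyC n c x y0 v = -e := by
    apply ext_inner_right ℝ; intro w
    rw [inner_DxyC h.oO h.hC hz0, r1 w, inner_neg_left]
  have d2 : DxyC n c x y0 a = -(DxxyC n c x y0 v v) := by
    apply ext_inner_right ℝ; intro w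
    rw [inner_DxyC h.oO h.hC hz0, inner_neg_left, inner_DxxyC h.oO h.hC hz0]
    linarith [r2 w]
  have hinv : (DxyC n c x y0).IsInvertible := by
    apply clm_isInvertible_of_injective
    intro v' hv'
    apply h.N1 _ hz0
    intro w
    rw [← inner_DxyC h.oO h.hC hz0, hv', inner_zero_left]
  have b0 : ∀ u', ‖u'‖ ≤ β * ‖DxyC n c x y0 u'‖ := by
    intro u'
    have : u' = (DxyC n c x y0).inverse (DxyC n c x y0 u') := by
      rw [hinv.inverse_apply_self]
    calc ‖u'‖ = ‖(DxyC n c x y0).inverse (DxyC n c x y0 u')‖ := by rw [← this]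
      _ ≤ ‖(DxyC n c x y0).inverse‖ * ‖DxyC n c x y0 u'‖ := ContinuousLinearMap.le_opNorm _ _
      _ ≤ _ := by gcongr; exact hβ (x, y0) hz0
  have bv : ‖v‖ ≤ β * ‖e‖ := by have := b0 v; rwa [d1, norm_neg] at this
  have ba : ‖a‖ ≤ β * (T * (β * ‖e‖) ^ 2) := by
    have := b0 a
    rw [d2, norm_neg] at this
    refine this.trans ?_
    gcongr
    refine ((DxxyC n c x y0).le_opNorm₂ v v).trans ?_
    rw [mul_assoc, ← sq]
    gcongr
    exact hT (x, y0) hz0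
  have bK2 : ∀ y ∈ V, |K2 c (x, y) (v, 0) (v, 0)| ≤ A * (β * ‖e‖) ^ 2 := by
    intro y hy
    rw [← inner_DxxC h.oO h.hC (mk_mem_prod hXt hy)]
    refine (abs_real_inner_le_norm _ _).trans ?_
    calc ‖DxxC n c x y v‖ * ‖v‖ ≤ (‖DxxC n c x y‖ * ‖v‖) * ‖v‖ := by
          gcongr; exact ContinuousLinearMap.le_opNorm _ _
      _ = ‖DxxC n c x y‖ * ‖v‖ ^ 2 := by ring
      _ ≤ _ := by gcongr; exact hA (x, y) (mk_mem_prod hXt hy)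
  have bK1 : ∀ y ∈ V, |K1 c (x, y) (a, 0)| ≤ G * (β * (T * (β * ‖e‖) ^ 2)) := by
    intro y hy
    rw [h.K1_eq hXt hy]
    refine (abs_real_inner_le_norm _ _).trans ?_
    gcongr
    exact hG (x, y) (mk_mem_prod hXt hy)
  have k1 := abs_le.mp (bK2 y0 hy0)
  have k2 := abs_le.mp (bK2 y1 hy1)
  have k3 := abs_le.mp (bK1 y0 hy0)
  have k4 := abs_le.mp (bK1 y1 hy1)
  have : 2 * (β ^ 2 * A + β ^ 3 * G * T) * ‖e‖ ^ 2 =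
      2 * (A * (β * ‖e‖) ^ 2) + 2 * (G * (β * (T * (β * ‖e‖) ^ 2))) := by ring
  rw [this]
  linarith [k1.1, k2.2, k3.1, k4.2]

/-- Semi-convexity along c-segments, interior version. -/
lemma Nice.ineq_semi (h : Nice n c U V) {β A G T : ℝ}
    (hβ : ∀ z ∈ U ×ˢ V, ‖(DxyC n c z.1 z.2).inverse‖ ≤ β)
    (hA : ∀ z ∈ U ×ˢ V, ‖DxxC n c z.1 z.2‖ ≤ A)
    (hG : ∀ z ∈ U ×ˢ V, ‖gradX n c z.1 z.2‖ ≤ G)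
    (hT : ∀ z ∈ U ×ˢ V, ‖DxxyC n c z.1 z.2‖ ≤ T) {x0 x1 x y0 y1 : Euc n}
    (hx0 : x0 ∈ U) (hx1 : x1 ∈ U) (hx : x ∈ U) (hy0 : y0 ∈ V) (hy1 : y1 ∈ V) {s : ℝ}
    (hs : s ∈ Icc (0 : ℝ) 1)
    (he : -gradY n c x y0 = -gradY n c x0 y0 + s • (-gradY n c x1 y0 - -gradY n c x0 y0)) :
    -c x y1 + c x y0 + (β ^ 2 * A + β ^ 3 * G * T) * ‖-gradY n c x y0‖ ^ 2 ≤
      (1 - s) * (-c x0 y1 + c x0 y0 + (β ^ 2 * A + β ^ 3 * G * T) * ‖-gradY n c x0 y0‖ ^ 2) +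
      s * (-c x1 y1 + c x1 y0 + (β ^ 2 * A + β ^ 3 * G * T) * ‖-gradY n c x1 y0‖ ^ 2) := by
  obtain ⟨X, X1, X2, hX0, hX1, hX⟩ := h.cseg hx0 hx1 hy0
  have hxs : X s = x := h.injX y0 hy0 (hX s hs).1 hx ((hX s hs).2.1.trans he.symm)
  set M := β ^ 2 * A + β ^ 3 * G * T with hM
  set q0 := -gradY n c x0 y0 with hq0
  set q1 := -gradY n c x1 y0 with hq1
  set e := q1 - q0 with hee
  have := convex_ineq_of_hda
    (f := fun s => (-c (X s) y1 + c (X s) y0) +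
      (M * ‖q0‖ ^ 2 + (2 * M * inner ℝ q0 e) * s + M * ‖e‖ ^ 2 * s ^ 2))
    (f1 := fun s => (-K1 c (X s, y1) (X1 s, 0) + K1 c (X s, y0) (X1 s, 0)) +
      ((2 * M * inner ℝ q0 e) + (2 * M * ‖e‖ ^ 2) * s))
    (f2 := fun s => (-(K2 c (X s, y1) (X1 s, 0) (X1 s, 0) + K1 c (X s, y1) (X2 s, 0)) +
        (K2 c (X s, y0) (X1 s, 0) (X1 s, 0) + K1 c (X s, y0) (X2 s, 0))) + 2 * M * ‖e‖ ^ 2)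
    (fun t ht => by
      refine (h.phi_hda hy0 hy1 (hX t ht).1 (hX t ht).2.2.1 (hX t ht).2.2.2.1).1.add ?_
      have e2 : HasDerivAt (fun s : ℝ => M * ‖e‖ ^ 2 * s ^ 2) (M * ‖e‖ ^ 2 * (2 * t)) t := by
        simpa using ((hasDerivAt_id t).pow 2).const_mul (M * ‖e‖ ^ 2)
      refine (((hda_lin (2 * M * inner ℝ q0 e) t).const_add (M * ‖q0‖ ^ 2)).add e2).congr_deriv ?_
      ring)
    (fun t ht => by
      refine (h.phi_hda hy0 hy1 (hX t ht).1 (hX t ht).2.2.1 (hX t ht).2.2.2.1).2.add ?_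
      exact (hda_lin (2 * M * ‖e‖ ^ 2) t).const_add (2 * M * inner ℝ q0 e))
    (fun t ht => by
      obtain ⟨hXt, -, -, -, r1, r2⟩ := hX t ht
      have := h.phi2_bound hβ hA hG hT hXt hy0 hy1 r1 r2
      linarith) hs
  simp only [hX0, hX1, hxs] at this
  have hq : ‖-gradY n c x y0‖ ^ 2 = ‖q0‖ ^ 2 + 2 * s * inner ℝ q0 e + s ^ 2 * ‖e‖ ^ 2 := by
    rw [he, norm_add_sq_real, inner_smul_right, norm_smul, mul_pow, Real.norm_eq_abs, sq_abs]; ring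
  have hq1' : ‖q1‖ ^ 2 = ‖q0‖ ^ 2 + 2 * inner ℝ q0 e + ‖e‖ ^ 2 := by
    have : q1 = q0 + e := by simp [hee]
    rw [this, norm_add_sq_real]
  rw [hq, hq1']
  nlinarith [this]

end Interior2

section Boundary

set_option maxSynthPendingDepth 4

variable {n : ℕ}

/-- Iterated derivatives of the cost within the closed product domain. -/
noncomputable def W1 (c : Euc n → Euc n → ℝ) (S : Set (Euc n × Euc n)) :
    Euc n × Euc n → (Euc n × Euc n →L[ℝ] ℝ) :=
  fderivWithin ℝ (Function.uncurry c) S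
noncomputable def W2 (c : Euc n → Euc n → ℝ) (S : Set (Euc n × Euc n)) :
    Euc n × Euc n → (Euc n × Euc n →L[ℝ] Euc n × Euc n →L[ℝ] ℝ) :=
  fderivWithin ℝ (W1 c S) S
noncomputable def W3 (c : Euc n → Euc n → ℝ) (S : Set (Euc n × Euc n)) :
    Euc n × Euc n → (Euc n × Euc n →L[ℝ] Euc n × Euc n →L[ℝ] Euc n × Euc n →L[ℝ] ℝ) :=
  fderivWithin ℝ (W2 c S) S

variable {c : Euc n → Euc n → ℝ} {S Ω : Set (Euc n × Euc n)} {U V : Set (Euc n)}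

lemma contDiffOn_W1 (hS : UniqueDiffOn ℝ S) (hC : ContDiffOn ℝ 4 (Function.uncurry c) S) :
    ContDiffOn ℝ 3 (W1 c S) S := hC.fderivWithin hS (by norm_num)
lemma contDiffOn_W2 (hS : UniqueDiffOn ℝ S) (hC : ContDiffOn ℝ 4 (Function.uncurry c) S) :
    ContDiffOn ℝ 2 (W2 c S) S := (contDiffOn_W1 hS hC).fderivWithin hS (by norm_num)
lemma contDiffOn_W3 (hS : UniqueDiffOn ℝ S) (hC : ContDiffOn ℝ 4 (Function.uncurry c) S) :
    ContDiffOn ℝ 1 (W3 c S) S := (contDiffOn_W2 hS hC).fderivWithin hS (by norm_num)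

lemma W1_eq (hΩ : IsOpen Ω) (hsub : Ω ⊆ S) {z : Euc n × Euc n} (hz : z ∈ Ω) :
    W1 c S z = K1 c z :=
  fderivWithin_of_mem_nhds (Filter.mem_of_superset (hΩ.mem_nhds hz) hsub)
lemma W2_eq (hΩ : IsOpen Ω) (hsub : Ω ⊆ S) {z : Euc n × Euc n} (hz : z ∈ Ω) :
    W2 c S z = K2 c z := by
  have h1 : W2 c S z = fderiv ℝ (W1 c S) z :=
    fderivWithin_of_mem_nhds (Filter.mem_of_superset (hΩ.mem_nhds hz) hsub)
  rw [h1]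
  refine Filter.EventuallyEq.fderiv_eq ?_
  filter_upwards [hΩ.mem_nhds hz] with z' hz' using W1_eq hΩ hsub hz'
lemma W3_eq (hΩ : IsOpen Ω) (hsub : Ω ⊆ S) {z : Euc n × Euc n} (hz : z ∈ Ω) :
    W3 c S z = K3 c z := by
  have h1 : W3 c S z = fderiv ℝ (W2 c S) z :=
    fderivWithin_of_mem_nhds (Filter.mem_of_superset (hΩ.mem_nhds hz) hsub)
  rw [h1]
  refine Filter.EventuallyEq.fderiv_eq ?_
  filter_upwards [hΩ.mem_nhds hz] with z' hz' using W2_eq hΩ hsub hz'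

lemma gradY_eq_W (hS : UniqueDiffOn ℝ (closure U)) (hV : UniqueDiffOn ℝ (closure V))
    (hC : ContDiffOn ℝ 4 (Function.uncurry c) (closure U ×ˢ closure V))
    (hB1 : B1cond n c U V) {x y : Euc n} (hx : x ∈ closure U) (hy : y ∈ closure V) :
    gradY n c x y = Q2 n (W1 c (closure U ×ˢ closure V) (x, y)) := by
  have hP := hS.prod hV
  rcases Nat.eq_zero_or_pos n with rfl | hn
  · exact Subsingleton.elim _ _
  have key : ∀ x' ∈ closure U, DifferentiableAt ℝ (fun y' => c x' y') y →
      gradY n c x' y = Q2 n (W1 c (closure U ×ˢ closure V) (x', y)) := by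
    intro x' hx' hd
    apply eq_Q2
    intro w
    have h1 : HasFDerivWithinAt (fun y' => c x' y') (fderiv ℝ (fun y' => c x' y') y)
      (closure V) y := hd.hasFDerivAt.hasFDerivWithinAt
    have hz : (x', y) ∈ closure U ×ˢ closure V := ⟨hx', hy⟩
    have h2 : HasFDerivWithinAt (Function.uncurry c) (W1 c (closure U ×ˢ closure V) (x', y))
      (closure U ×ˢ closure V) (x', y) :=
      ((hC.differentiableOn (by norm_num)) _ hz).hasFDerivWithinAt
    have h3 := h2.comp y (hasFDerivAt_prodMk_right x' y).hasFDerivWithinAt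
      (show MapsTo (fun y' => (x', y')) (closure V) (closure U ×ˢ closure V) from
        fun y' hy' => ⟨hx', hy'⟩)
    have h4 := (hV y hy).eq h1 h3
    unfold gradY
    rw [inner_gradient_left, h4]
    simp
  by_cases hd : DifferentiableAt ℝ (fun y' => c x y') y
  · exact key x hx hd
  have h0 : gradY n c x y = 0 := gradient_eq_zero_of_not_differentiableAt hd
  haveI : Nonempty (Fin n) := ⟨⟨0, hn⟩⟩
  have hacc := (hS x hx).accPt
  have hF : ContinuousOn (fun x' => gradY n c x' y) (closure U) := by
    have := (hB1.1 y hy).2.1.continuousOn.neg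
    exact this.congr fun x' _ => (neg_neg _).symm
  have hG : ContinuousOn (fun x' => Q2 n (W1 c (closure U ×ˢ closure V) (x', y))) (closure U) := by
    refine (Q2 n).continuous.comp_continuousOn ?_
    refine (contDiffOn_W1 hP hC).continuousOn.comp
      (Continuous.prodMk_left y).continuousOn ?_
    exact fun x' hx' => ⟨hx', hy⟩
  rw [accPt_iff_frequently_nhdsNE] at hacc
  have hne : (nhdsWithin x (closure U \ {x})).NeBot := by
    rw [← mem_closure_iff_nhdsWithin_neBot, mem_closure_iff_frequently]
    rw [frequently_nhdsWithin_iff] at hacc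
    exact hacc.mono fun a ha => ⟨ha.1, ha.2⟩
  have t1 : Filter.Tendsto (fun x' => gradY n c x' y) (nhdsWithin x (closure U \ {x}))
      (nhds (gradY n c x y)) := (hF x hx).mono_left (nhdsWithin_mono _ sdiff_subset)
  have t2 : Filter.Tendsto (fun x' => Q2 n (W1 c (closure U ×ˢ closure V) (x', y)))
      (nhdsWithin x (closure U \ {x}))
      (nhds (Q2 n (W1 c (closure U ×ˢ closure V) (x, y)))) :=
    (hG x hx).mono_left (nhdsWithin_mono _ sdiff_subset)
  refine tendsto_nhds_unique t1 (t2.congr' ?_)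
  filter_upwards [self_mem_nhdsWithin] with x' hx'
  refine (key x' hx'.1 ?_).symm
  by_contra hd'
  have h0' : gradY n c x' y = 0 := gradient_eq_zero_of_not_differentiableAt hd'
  exact hx'.2 ((hB1.1 y hy).1 hx'.1 hx (by simp [h0, h0']))

lemma uniqueDiffU (hB0 : B0cond n c U V) (hB1 : B1cond n c U V) (hB2 : B2cond n c U V)
    (hU : U.Nonempty) (hV : V.Nonempty) : UniqueDiffOn ℝ (closure U) := by
  obtain ⟨y, hy⟩ := hV
  exact uniqueDiffOn_of_diffeo hB0.1 hB0.2.1 hU (hB1.1 y (subset_closure hy))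
    (hB2.1 y (subset_closure hy))

lemma uniqueDiffV (hB0 : B0cond n c U V) (hB1 : B1cond n c U V) (hB2 : B2cond n c U V)
    (hU : U.Nonempty) (hV : V.Nonempty) : UniqueDiffOn ℝ (closure V) := by
  obtain ⟨x, hx⟩ := hU
  exact uniqueDiffOn_of_diffeo hB0.2.2.1 hB0.2.2.2.1 hV (hB1.2 x (subset_closure hx))
    (hB2.2 x (subset_closure hx))

lemma compactS (hB0 : B0cond n c U V) : IsCompact (closure U ×ˢ closure V) :=
  hB0.2.1.isCompact_closure.prod hB0.2.2.2.1.isCompact_closure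

lemma gradY_continuousOn (hB0 : B0cond n c U V) (hB1 : B1cond n c U V) (hB2 : B2cond n c U V)
    (hU : U.Nonempty) (hV : V.Nonempty) :
    ContinuousOn (fun z : Euc n × Euc n => gradY n c z.1 z.2) (closure U ×ˢ closure V) := by
  have h1 := uniqueDiffU hB0 hB1 hB2 hU hV
  have h2 := uniqueDiffV hB0 hB1 hB2 hU hV
  have hc := (Q2 n).continuous.comp_continuousOn
    (contDiffOn_W1 (h1.prod h2) hB0.2.2.2.2).continuousOn
  exact hc.congr fun z hz => gradY_eq_W h1 h2 hB0.2.2.2.2 hB1 hz.1 hz.2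

lemma nice_of_B (hB0 : B0cond n c U V) (hB1 : B1cond n c U V) (hB2 : B2cond n c U V)
    (hU : U.Nonempty) (hV : V.Nonempty) : Nice n c U V := by
  have h1 := uniqueDiffU hB0 hB1 hB2 hU hV
  have h2 := uniqueDiffV hB0 hB1 hB2 hU hV
  have hO : IsOpen (U ×ˢ V) := hB0.1.prod hB0.2.2.1
  have hC : ContDiffOn ℝ 4 (Function.uncurry c) (U ×ˢ V) :=
    hB0.2.2.2.2.mono (prod_mono subset_closure subset_closure)
  refine ⟨hB0.1, hB0.2.2.1, hC, ?_, ?_, fun y hy => (hB1.1 y (subset_closure hy)).1.mono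
    subset_closure, fun x hx => (hB1.2 x (subset_closure hx)).1.mono subset_closure,
    fun y hy => hB2.1 y (subset_closure hy), fun x hx => hB2.2 x (subset_closure hx)⟩
  · rintro ⟨x, y⟩ hz v hv
    have hd := (hasFDerivAt_gradY_l hO hC hz).neg
    refine injective_of_diffeo (hB1.1 y (subset_closure hz.2)) (subset_closure hz.1)
      (h1 x (subset_closure hz.1)) hd.hasFDerivWithinAt v ?_
    show -(PQ n (Q2 n) (K2 c (x, y)) v) = 0
    rw [neg_eq_zero, PQ_apply]
    refine ext_inner_right ℝ fun w => ?_
    rw [inner_Q2, hv w, inner_zero_left]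
  · rintro ⟨x, y⟩ hz w hw
    have hd : HasFDerivAt (fun y' => gradX n c x y')
        ((Q1 n).comp ((K2 c (x, y)).comp (ContinuousLinearMap.inr ℝ (Euc n) (Euc n)))) y := by
      have h := (Q1 n).hasFDerivAt.comp y (hasFDerivAt_mkr (hasFDerivAt_K1 hO hC hz))
      refine HasFDerivAt.congr_of_eventuallyEq h ?_
      filter_upwards [nhds_slice_r hO hz] with y' hy' using gradX_eq hO hC hy'
    refine injective_of_diffeo (hB1.2 x (subset_closure hz.1)) (subset_closure hz.2)
      (h2 y (subset_closure hz.2)) hd.neg.hasFDerivWithinAt w ?_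
    show -(Q1 n (K2 c (x, y) (0, w))) = 0
    rw [neg_eq_zero]
    refine ext_inner_right ℝ fun v => ?_
    rw [inner_Q1, hw v, inner_zero_left]

lemma bdd_of_cont {G : Type*} [NormedAddCommGroup G] {f : Euc n → Euc n → G}
    {F : Euc n × Euc n → G} (hB0 : B0cond n c U V)
    (hF : ContinuousOn F (closure U ×ˢ closure V))
    (he : ∀ z ∈ U ×ˢ V, f z.1 z.2 = F z) :
    ∀ z ∈ U ×ˢ V, ‖f z.1 z.2‖ ≤ sSup ((fun p : Euc n × Euc n => ‖f p.1 p.2‖) '' (U ×ˢ V)) := by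
  obtain ⟨M, hM⟩ := (compactS hB0).exists_bound_of_continuousOn hF
  intro z hz
  refine le_csSup ⟨M, ?_⟩ (mem_image_of_mem (fun p : Euc n × Euc n => ‖f p.1 p.2‖) hz)
  rintro _ ⟨p, hp, rfl⟩
  beta_reduce
  rw [he p hp]
  exact hM p ⟨subset_closure hp.1, subset_closure hp.2⟩

lemma le_supDx (hB0 : B0cond n c U V) (hB1 : B1cond n c U V) (hB2 : B2cond n c U V)
    (hU : U.Nonempty) (hV : V.Nonempty) :
    ∀ z ∈ U ×ˢ V, ‖gradX n c z.1 z.2‖ ≤ supDx n c U V := by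
  have hP := (uniqueDiffU hB0 hB1 hB2 hU hV).prod (uniqueDiffV hB0 hB1 hB2 hU hV)
  have hN := nice_of_B hB0 hB1 hB2 hU hV
  have hO : IsOpen (U ×ˢ V) := hB0.1.prod hB0.2.2.1
  have hsub : U ×ˢ V ⊆ closure U ×ˢ closure V := prod_mono subset_closure subset_closure
  refine bdd_of_cont hB0 ((Q1 n).continuous.comp_continuousOn
    (contDiffOn_W1 hP hB0.2.2.2.2).continuousOn) ?_
  rintro ⟨x, y⟩ hz
  show gradX n c x y = Q1 n (W1 c _ (x, y))
  rw [W1_eq hO hsub hz, gradX_eq hO hN.hC hz]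

lemma le_supDxx (hB0 : B0cond n c U V) (hB1 : B1cond n c U V) (hB2 : B2cond n c U V)
    (hU : U.Nonempty) (hV : V.Nonempty) :
    ∀ z ∈ U ×ˢ V, ‖DxxC n c z.1 z.2‖ ≤ supDxx n c U V := by
  have hP := (uniqueDiffU hB0 hB1 hB2 hU hV).prod (uniqueDiffV hB0 hB1 hB2 hU hV)
  have hN := nice_of_B hB0 hB1 hB2 hU hV
  have hO : IsOpen (U ×ˢ V) := hB0.1.prod hB0.2.2.1
  have hsub : U ×ˢ V ⊆ closure U ×ˢ closure V := prod_mono subset_closure subset_closure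
  refine bdd_of_cont hB0 ((PQ n (Q1 n)).continuous.comp_continuousOn
    (contDiffOn_W2 hP hB0.2.2.2.2).continuousOn) ?_
  rintro ⟨x, y⟩ hz
  show DxxC n c x y = PQ n (Q1 n) (W2 c _ (x, y))
  rw [W2_eq hO hsub hz, DxxC_eq hO hN.hC hz]

lemma le_supDxxy (hB0 : B0cond n c U V) (hB1 : B1cond n c U V) (hB2 : B2cond n c U V)
    (hU : U.Nonempty) (hV : V.Nonempty) :
    ∀ z ∈ U ×ˢ V, ‖DxxyC n c z.1 z.2‖ ≤ supDxxy n c U V := by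
  have hP := (uniqueDiffU hB0 hB1 hB2 hU hV).prod (uniqueDiffV hB0 hB1 hB2 hU hV)
  have hN := nice_of_B hB0 hB1 hB2 hU hV
  have hO : IsOpen (U ×ˢ V) := hB0.1.prod hB0.2.2.1
  have hsub : U ×ˢ V ⊆ closure U ×ˢ closure V := prod_mono subset_closure subset_closure
  have hc : ContinuousOn (fun z => (PQ n (Q2 n)).comp
      ((W3 c (closure U ×ˢ closure V) z).comp (ContinuousLinearMap.inl ℝ (Euc n) (Euc n))))
      (closure U ×ˢ closure V) :=
    continuousOn_const.clm_comp
      ((contDiffOn_W3 hP hB0.2.2.2.2).continuousOn.clm_comp continuousOn_const)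
  refine bdd_of_cont hB0 hc ?_
  rintro ⟨x, y⟩ hz
  beta_reduce
  rw [W3_eq hO hsub hz, ← DxxyC_eq hO hN.hC hz]

lemma le_betaMinus (hB0 : B0cond n c U V) (hB1 : B1cond n c U V) (hB2 : B2cond n c U V)
    (hU : U.Nonempty) (hV : V.Nonempty) :
    ∀ z ∈ U ×ˢ V, ‖(DxyC n c z.1 z.2).inverse‖ ≤ betaMinus n c U V := by
  have h1 := uniqueDiffU hB0 hB1 hB2 hU hV
  have h2 := uniqueDiffV hB0 hB1 hB2 hU hV
  have hP := h1.prod h2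
  have hN := nice_of_B hB0 hB1 hB2 hU hV
  have hO : IsOpen (U ×ˢ V) := hB0.1.prod hB0.2.2.1
  have hsub : U ×ˢ V ⊆ closure U ×ˢ closure V := prod_mono subset_closure subset_closure
  have hinv : ∀ z ∈ closure U ×ˢ closure V,
      (PQ n (Q2 n) (W2 c (closure U ×ˢ closure V) z)).IsInvertible := by
    rintro ⟨x, y⟩ hz
    apply clm_isInvertible_of_injective
    intro v hv
    have hW : HasFDerivWithinAt (W1 c (closure U ×ˢ closure V))
        (W2 c (closure U ×ˢ closure V) (x, y)) (closure U ×ˢ closure V) (x, y) :=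
      (((contDiffOn_W1 hP hB0.2.2.2.2).differentiableOn (by norm_num)) _ hz).hasFDerivWithinAt
    have h3 := hW.comp x (hasFDerivAt_prodMk_left x y).hasFDerivWithinAt
      (show MapsTo (fun x' => (x', y)) (closure U) (closure U ×ˢ closure V) from
        fun x' hx' => ⟨hx', hz.2⟩)
    have h4 := (Q2 n).hasFDerivAt.comp_hasFDerivWithinAt x h3
    have h5 : HasFDerivWithinAt (fun x' => gradY n c x' y)
        (PQ n (Q2 n) (W2 c (closure U ×ˢ closure V) (x, y))) (closure U) x :=
      h4.congr (fun x' hx' => gradY_eq_W h1 h2 hB0.2.2.2.2 hB1 hx' hz.2)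
        (gradY_eq_W h1 h2 hB0.2.2.2.2 hB1 hz.1 hz.2)
    refine injective_of_diffeo (hB1.1 y hz.2) hz.1 (h1 x hz.1) h5.neg v ?_
    show -(PQ n (Q2 n) (W2 c _ (x, y)) v) = 0
    rw [hv, neg_zero]
  have hc : ContinuousOn
      (fun z => (PQ n (Q2 n) (W2 c (closure U ×ˢ closure V) z)).inverse)
      (closure U ×ˢ closure V) := by
    intro z hz
    have ha : ContinuousWithinAt (fun z => PQ n (Q2 n) (W2 c (closure U ×ˢ closure V) z))
      (closure U ×ˢ closure V) z := ((PQ n (Q2 n)).continuous.comp_continuousOn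
      (contDiffOn_W2 hP hB0.2.2.2.2).continuousOn) z hz
    have hb := ((hinv z hz).contDiffAt_map_inverse (n := 1)).continuousAt
    exact Filter.Tendsto.comp hb ha
  refine bdd_of_cont (f := fun x y => (DxyC n c x y).inverse) hB0 hc ?_
  rintro ⟨x, y⟩ hz
  beta_reduce
  rw [W2_eq hO hsub hz, ← DxyC_eq hO hN.hC hz]

end Boundary

section ClosureStep

variable {n : ℕ} {c : Euc n → Euc n → ℝ} {U V : Set (Euc n)}

lemma tendsto_pair {G : Type*} [TopologicalSpace G] {F : Euc n × Euc n → G}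
    (hF : ContinuousOn F (closure U ×ˢ closure V)) {p b : ℕ → Euc n} {p' b' : Euc n}
    (hp : ∀ k, p k ∈ U) (hb : ∀ k, b k ∈ V) (hp' : p' ∈ closure U) (hb' : b' ∈ closure V)
    (tp : Filter.Tendsto p Filter.atTop (nhds p')) (tb : Filter.Tendsto b Filter.atTop (nhds b')) :
    Filter.Tendsto (fun k => F (p k, b k)) Filter.atTop (nhds (F (p', b'))) := by
  refine Filter.Tendsto.comp (hF (p', b') ⟨hp', hb'⟩) ?_
  refine tendsto_nhdsWithin_iff.2 ⟨tp.prodMk_nhds tb, ?_⟩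
  exact Filter.Eventually.of_forall fun k => ⟨subset_closure (hp k), subset_closure (hb _)⟩

/-- Approximation of a configuration on the closure by interior configurations. -/
lemma exists_approx (hB0 : B0cond n c U V) (hB1 : B1cond n c U V) (hB2 : B2cond n c U V)
    (hU : U.Nonempty) (hV : V.Nonempty) {x0 x1 x y0 y1 : Euc n}
    (hx0 : x0 ∈ closure U) (hx1 : x1 ∈ closure U) (hx : x ∈ closure U)
    (hy0 : y0 ∈ closure V) (hy1 : y1 ∈ closure V) {s : ℝ} (hs : s ∈ Icc (0 : ℝ) 1)
    (he : -gradY n c x y0 = -gradY n c x0 y0 + s • (-gradY n c x1 y0 - -gradY n c x0 y0)) :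
    ∃ a0 a1 a b0 b1 : ℕ → Euc n,
      (∀ k, a0 k ∈ U ∧ a1 k ∈ U ∧ a k ∈ U ∧ b0 k ∈ V ∧ b1 k ∈ V ∧
        -gradY n c (a k) (b0 k) = -gradY n c (a0 k) (b0 k) +
          s • (-gradY n c (a1 k) (b0 k) - -gradY n c (a0 k) (b0 k))) ∧
      Filter.Tendsto a0 Filter.atTop (nhds x0) ∧ Filter.Tendsto a1 Filter.atTop (nhds x1) ∧
      Filter.Tendsto a Filter.atTop (nhds x) ∧ Filter.Tendsto b0 Filter.atTop (nhds y0) ∧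
      Filter.Tendsto b1 Filter.atTop (nhds y1) := by
  obtain ⟨a0, ha0, ta0⟩ := mem_closure_iff_seq_limit.1 hx0
  obtain ⟨a1, ha1, ta1⟩ := mem_closure_iff_seq_limit.1 hx1
  obtain ⟨b0, hb0, tb0⟩ := mem_closure_iff_seq_limit.1 hy0
  obtain ⟨b1, hb1, tb1⟩ := mem_closure_iff_seq_limit.1 hy1
  have hex : ∀ k, ∃ a ∈ U, -gradY n c a (b0 k) = -gradY n c (a0 k) (b0 k) +
          s • (-gradY n c (a1 k) (b0 k) - -gradY n c (a0 k) (b0 k)) := by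
    intro k
    exact (hB2.1 (b0 k) (subset_closure (hb0 k))).add_smul_sub_mem
      (mem_image_of_mem (fun x => -gradY n c x (b0 k)) (ha0 k))
      (mem_image_of_mem (fun x => -gradY n c x (b0 k)) (ha1 k)) hs
  choose a ha hae using hex
  obtain ⟨x', hx', φ, hφ, tφ⟩ := hB0.2.1.isCompact_closure.tendsto_subseq
    (fun k => subset_closure (ha k))
  have hcont : ContinuousOn (fun z : Euc n × Euc n => -gradY n c z.1 z.2)
    (closure U ×ˢ closure V) := (gradY_continuousOn hB0 hB1 hB2 hU hV).neg
  have tφ' := hφ.tendsto_atTop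
  have hlim : ∀ (p : ℕ → Euc n) (p' : Euc n), (∀ k, p k ∈ U) → p' ∈ closure U →
      Filter.Tendsto p Filter.atTop (nhds p') →
      Filter.Tendsto (fun k => -gradY n c (p k) (b0 (φ k))) Filter.atTop
        (nhds (-gradY n c p' y0)) := by
    intro p p' hp hp' tp
    exact tendsto_pair (F := fun z : Euc n × Euc n => -gradY n c z.1 z.2) (b := b0 ∘ φ) hcont hp
      (fun k => hb0 _) hp' hy0 tp (tb0.comp tφ')
  have l0 := hlim (a0 ∘ φ) x0 (fun k => ha0 _) hx0 (ta0.comp tφ')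
  have l1 := hlim (a1 ∘ φ) x1 (fun k => ha1 _) hx1 (ta1.comp tφ')
  have l := hlim (a ∘ φ) x' (fun k => ha _) hx' tφ
  have lr := l0.add ((l1.sub l0).const_smul s)
  have heq := tendsto_nhds_unique (l.congr fun k => hae (φ k)) lr
  rw [← he] at heq
  have hxx : x' = x := (hB1.1 y0 hy0).1 hx' hx heq
  subst hxx
  exact ⟨a0 ∘ φ, a1 ∘ φ, a ∘ φ, b0 ∘ φ, b1 ∘ φ,
    fun k => ⟨ha0 _, ha1 _, ha _, hb0 _, hb1 _, hae _⟩, ta0.comp tφ', ta1.comp tφ', tφ,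
    tb0.comp tφ', tb1.comp tφ'⟩

/-- The potential difference `f(x) = -c(x,y1) + c(x,y0) + M |q|²`. -/
noncomputable def fM (n : ℕ) (c : Euc n → Euc n → ℝ) (M : ℝ) (y0 y1 x : Euc n) : ℝ :=
  -c x y1 + c x y0 + M * ‖-gradY n c x y0‖ ^ 2

lemma tendsto_fM (hB0 : B0cond n c U V) (hB1 : B1cond n c U V) (hB2 : B2cond n c U V)
    (hU : U.Nonempty) (hV : V.Nonempty) (M : ℝ) {p b0 b1 : ℕ → Euc n} {p' y0 y1 : Euc n}
    (hp : ∀ k, p k ∈ U) (hb0 : ∀ k, b0 k ∈ V) (hb1 : ∀ k, b1 k ∈ V)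
    (hp' : p' ∈ closure U) (hy0 : y0 ∈ closure V) (hy1 : y1 ∈ closure V)
    (tp : Filter.Tendsto p Filter.atTop (nhds p'))
    (t0 : Filter.Tendsto b0 Filter.atTop (nhds y0))
    (t1 : Filter.Tendsto b1 Filter.atTop (nhds y1)) :
    Filter.Tendsto (fun k => fM n c M (b0 k) (b1 k) (p k)) Filter.atTop
      (nhds (fM n c M y0 y1 p')) := by
  have hc := hB0.2.2.2.2.continuousOn
  have hg : ContinuousOn (fun z : Euc n × Euc n => ‖-gradY n c z.1 z.2‖)
    (closure U ×ˢ closure V) := (gradY_continuousOn hB0 hB1 hB2 hU hV).neg.norm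
  have h1 := tendsto_pair hc hp hb1 hp' hy1 tp t1
  have h0 := tendsto_pair hc hp hb0 hp' hy0 tp t0
  have h2 := tendsto_pair hg hp hb0 hp' hy0 tp t0
  exact (h1.neg.add h0).add ((h2.pow 2).const_mul M)

lemma closure_quasi (hB0 : B0cond n c U V) (hB1 : B1cond n c U V) (hB2 : B2cond n c U V)
    (hU : U.Nonempty) (hV : V.Nonempty) {x0 x1 x y0 y1 : Euc n}
    (hx0 : x0 ∈ closure U) (hx1 : x1 ∈ closure U) (hx : x ∈ closure U)
    (hy0 : y0 ∈ closure V) (hy1 : y1 ∈ closure V) {s : ℝ} (hs : s ∈ Icc (0 : ℝ) 1)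
    (he : -gradY n c x y0 = -gradY n c x0 y0 + s • (-gradY n c x1 y0 - -gradY n c x0 y0))
    (hB3 : B3cond n c U V) :
    fM n c 0 y0 y1 x ≤ max (fM n c 0 y0 y1 x0) (fM n c 0 y0 y1 x1) := by
  obtain ⟨a0, a1, a, b0, b1, h, t0, t1, t, tb0, tb1⟩ :=
    exists_approx hB0 hB1 hB2 hU hV hx0 hx1 hx hy0 hy1 hs he
  have hN := nice_of_B hB0 hB1 hB2 hU hV
  have T := fun {p : ℕ → Euc n} {p' : Euc n} (hp : ∀ k, p k ∈ U) (hp' : p' ∈ closure U) tp =>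
    tendsto_fM hB0 hB1 hB2 hU hV 0 (p := p) (p' := p') hp (fun k => (h k).2.2.2.1)
      (fun k => (h k).2.2.2.2.1) hp' hy0 hy1 tp tb0 tb1
  refine le_of_tendsto_of_tendsto' (T (fun k => (h k).2.2.1) hx t)
    ((T (fun k => (h k).1) hx0 t0).max (T (fun k => (h k).2.1) hx1 t1)) fun k => ?_
  obtain ⟨g0, g1, g, gb0, gb1, ge⟩ := h k
  have := hN.ineq_quasi hB3 g0 g1 g gb0 gb1 hs ge
  simpa [fM] using this

lemma closure_convex (hB0 : B0cond n c U V) (hB1 : B1cond n c U V) (hB2 : B2cond n c U V)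
    (hU : U.Nonempty) (hV : V.Nonempty) {x0 x1 x y0 y1 : Euc n}
    (hx0 : x0 ∈ closure U) (hx1 : x1 ∈ closure U) (hx : x ∈ closure U)
    (hy0 : y0 ∈ closure V) (hy1 : y1 ∈ closure V) {s : ℝ} (hs : s ∈ Icc (0 : ℝ) 1)
    (he : -gradY n c x y0 = -gradY n c x0 y0 + s • (-gradY n c x1 y0 - -gradY n c x0 y0))
    (hB4 : B4cond n c U V) :
    fM n c 0 y0 y1 x ≤ (1 - s) * fM n c 0 y0 y1 x0 + s * fM n c 0 y0 y1 x1 := by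
  obtain ⟨a0, a1, a, b0, b1, h, t0, t1, t, tb0, tb1⟩ :=
    exists_approx hB0 hB1 hB2 hU hV hx0 hx1 hx hy0 hy1 hs he
  have hN := nice_of_B hB0 hB1 hB2 hU hV
  have T := fun {p : ℕ → Euc n} {p' : Euc n} (hp : ∀ k, p k ∈ U) (hp' : p' ∈ closure U) tp =>
    tendsto_fM hB0 hB1 hB2 hU hV 0 (p := p) (p' := p') hp (fun k => (h k).2.2.2.1)
      (fun k => (h k).2.2.2.2.1) hp' hy0 hy1 tp tb0 tb1
  refine le_of_tendsto_of_tendsto' (T (fun k => (h k).2.2.1) hx t)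
    (((T (fun k => (h k).1) hx0 t0).const_mul (1 - s)).add
      ((T (fun k => (h k).2.1) hx1 t1).const_mul s)) fun k => ?_
  obtain ⟨g0, g1, g, gb0, gb1, ge⟩ := h k
  have := hN.ineq_convex hB4 g0 g1 g gb0 gb1 hs ge
  simpa [fM] using this

lemma closure_semi (hB0 : B0cond n c U V) (hB1 : B1cond n c U V) (hB2 : B2cond n c U V)
    (hU : U.Nonempty) (hV : V.Nonempty) {x0 x1 x y0 y1 : Euc n}
    (hx0 : x0 ∈ closure U) (hx1 : x1 ∈ closure U) (hx : x ∈ closure U)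
    (hy0 : y0 ∈ closure V) (hy1 : y1 ∈ closure V) {s : ℝ} (hs : s ∈ Icc (0 : ℝ) 1)
    (he : -gradY n c x y0 = -gradY n c x0 y0 + s • (-gradY n c x1 y0 - -gradY n c x0 y0)) :
    fM n c (Mconst n c U V) y0 y1 x ≤ (1 - s) * fM n c (Mconst n c U V) y0 y1 x0
      + s * fM n c (Mconst n c U V) y0 y1 x1 := by
  obtain ⟨a0, a1, a, b0, b1, h, t0, t1, t, tb0, tb1⟩ :=
    exists_approx hB0 hB1 hB2 hU hV hx0 hx1 hx hy0 hy1 hs he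
  have hN := nice_of_B hB0 hB1 hB2 hU hV
  have T := fun {p : ℕ → Euc n} {p' : Euc n} (hp : ∀ k, p k ∈ U) (hp' : p' ∈ closure U) tp =>
    tendsto_fM hB0 hB1 hB2 hU hV (Mconst n c U V) (p := p) (p' := p') hp
      (fun k => (h k).2.2.2.1) (fun k => (h k).2.2.2.2.1) hp' hy0 hy1 tp tb0 tb1
  refine le_of_tendsto_of_tendsto' (T (fun k => (h k).2.2.1) hx t)
    (((T (fun k => (h k).1) hx0 t0).const_mul (1 - s)).add
      ((T (fun k => (h k).2.1) hx1 t1).const_mul s)) fun k => ?_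
  obtain ⟨g0, g1, g, gb0, gb1, ge⟩ := h k
  exact hN.ineq_semi (le_betaMinus hB0 hB1 hB2 hU hV) (le_supDxx hB0 hB1 hB2 hU hV)
    (le_supDx hB0 hB1 hB2 hU hV) (le_supDxxy hB0 hB1 hB2 hU hV) g0 g1 g gb0 gb1 hs ge

end ClosureStep

section Assembly

variable {n : ℕ} {c : Euc n → Euc n → ℝ} {U V : Set (Euc n)} {u : Euc n → ℝ}

lemma bddAbove_star (hB0 : B0cond n c U V)
    (hu : CConvexOn n c (closure U) (closure V) u) {y : Euc n} (hy : y ∈ closure V) :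
    BddAbove ((fun x => -c x y - u x) '' closure U) := by
  obtain ⟨C, hC⟩ := (compactS hB0).exists_bound_of_continuousOn hB0.2.2.2.2.continuousOn
  have hC' : ∀ x ∈ closure U, ∀ y ∈ closure V, -C ≤ c x y ∧ c x y ≤ C :=
    fun x hx y hy => abs_le.1 (hC (x, y) ⟨hx, hy⟩)
  by_contra hb
  have hall : ∀ y' ∈ closure V, cStarT n c (closure U) u y' = 0 := by
    intro y' hy'
    refine Real.sSup_of_not_bddAbove fun hb' => hb ?_
    obtain ⟨M, hM⟩ := hb'
    refine ⟨M + 2 * C, ?_⟩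
    rintro _ ⟨x, hx, rfl⟩
    have h1 := hM (mem_image_of_mem (fun x => -c x y' - u x) hx)
    have h2 := hC' x hx y hy
    have h3 := hC' x hx y' hy'
    beta_reduce at h1 ⊢
    linarith
  apply hb
  refine ⟨2 * C, ?_⟩
  rintro _ ⟨x, hx, rfl⟩
  have h1 := hu x hx
  have h2 : -c x y - cStarT n c (closure U) u y ≤ u x := by
    rw [h1]
    refine le_csSup ⟨C, ?_⟩ (mem_image_of_mem (fun y => -c x y - cStarT n c (closure U) u y) hy)
    rintro _ ⟨y', hy', rfl⟩
    beta_reduce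
    rw [hall y' hy']
    linarith [hC' x hx y' hy']
  rw [hall y hy] at h2
  beta_reduce
  linarith [hC' x hx y hy]

lemma le_star (hB0 : B0cond n c U V)
    (hu : CConvexOn n c (closure U) (closure V) u) {x y : Euc n} (hx : x ∈ closure U)
    (hy : y ∈ closure V) : -c x y - u x ≤ cStarT n c (closure U) u y :=
  le_csSup (bddAbove_star hB0 hu hy) (mem_image_of_mem (fun x => -c x y - u x) hx)

lemma u_le (hu : CConvexOn n c (closure U) (closure V) u) (hV : V.Nonempty) {x : Euc n}
    (hx : x ∈ closure U) {R : ℝ}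
    (h : ∀ y ∈ closure V, -c x y - cStarT n c (closure U) u y ≤ R) : u x ≤ R := by
  rw [hu x hx]
  refine csSup_le (hV.closure.image _) ?_
  rintro _ ⟨y, hy, rfl⟩
  exact h y hy

lemma xOf_eq (hB1 : B1cond n c U V) {ybar : Euc n} (hy : ybar ∈ closure V) {x : Euc n}
    (hx : x ∈ closure U) : xOf n c U ybar (-gradY n c x ybar) = x :=
  (hB1.1 ybar hy).1.leftInvOn_invFunOn hx

lemma convex_clUy (hB0 : B0cond n c U V) (hB1 : B1cond n c U V) (hB2 : B2cond n c U V)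
    {ybar : Euc n} (hy : ybar ∈ closure V) : Convex ℝ (clUy n c U ybar) := by
  have h : clUy n c U ybar = closure (Uyset n c U ybar) :=
    image_closure_of_isCompact hB0.2.1.isCompact_closure (hB1.1 ybar hy).2.1.continuousOn
  rw [h]
  exact (hB2.1 ybar hy).closure

lemma cStarT_mod (hB1 : B1cond n c U V) {ybar : Euc n} (hy : ybar ∈ closure V) (y : Euc n) :
    cStarT n (modCost n c U ybar) (clUy n c U ybar) (modPot n c U ybar u) y =
      cStarT n c (closure U) u y := by
  unfold cStarT clUy
  rw [image_image]
  congr 1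
  refine image_congr fun x hx => ?_
  unfold modCost modPot
  rw [xOf_eq hB1 hy hx]
  ring

/-- Points on a segment of `cl U_ȳ`, in original coordinates. -/
lemma seg_point (hB0 : B0cond n c U V) (hB1 : B1cond n c U V) (hB2 : B2cond n c U V)
    {ybar : Euc n} (hy : ybar ∈ closure V) {q0 q1 : Euc n} (h0 : q0 ∈ clUy n c U ybar)
    (h1 : q1 ∈ clUy n c U ybar) {a b : ℝ} (ha : 0 ≤ a) (hb : 0 ≤ b) (hab : a + b = 1) :
    ∃ x0 ∈ closure U, ∃ x1 ∈ closure U, ∃ x ∈ closure U, q0 = -gradY n c x0 ybar ∧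
      q1 = -gradY n c x1 ybar ∧ a • q0 + b • q1 = -gradY n c x ybar ∧
      -gradY n c x ybar = -gradY n c x0 ybar +
        b • (-gradY n c x1 ybar - -gradY n c x0 ybar) := by
  obtain ⟨x, hx, hxe⟩ := convex_clUy hB0 hB1 hB2 hy h0 h1 ha hb hab
  obtain ⟨x0, hx0, rfl⟩ := h0
  obtain ⟨x1, hx1, rfl⟩ := h1
  refine ⟨x0, hx0, x1, hx1, x, hx, rfl, rfl, hxe.symm, ?_⟩
  beta_reduce at hxe
  rw [hxe]
  obtain rfl : a = 1 - b := by linarith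
  module

lemma assemble_lin (hB0 : B0cond n c U V) (hu : CConvexOn n c (closure U) (closure V) u)
    (hV : V.Nonempty) {ybar x0 x1 x : Euc n} (hx0 : x0 ∈ closure U) (hx1 : x1 ∈ closure U)
    (hx : x ∈ closure U) {s M : ℝ} (hs : s ∈ Icc (0 : ℝ) 1)
    (h : ∀ y ∈ closure V, fM n c M ybar y x ≤
      (1 - s) * fM n c M ybar y x0 + s * fM n c M ybar y x1) :
    u x + c x ybar + M * ‖-gradY n c x ybar‖ ^ 2 ≤
      (1 - s) * (u x0 + c x0 ybar + M * ‖-gradY n c x0 ybar‖ ^ 2) +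
      s * (u x1 + c x1 ybar + M * ‖-gradY n c x1 ybar‖ ^ 2) := by
  have key := u_le hu hV hx (R := (1 - s) * (u x0 + c x0 ybar + M * ‖-gradY n c x0 ybar‖ ^ 2) +
      s * (u x1 + c x1 ybar + M * ‖-gradY n c x1 ybar‖ ^ 2) -
      (c x ybar + M * ‖-gradY n c x ybar‖ ^ 2)) ?_
  · linarith
  intro y hy
  have h1 := h y hy
  have e0 := mul_le_mul_of_nonneg_left (le_star hB0 hu hx0 hy) (sub_nonneg.2 hs.2)
  have e1 := mul_le_mul_of_nonneg_left (le_star hB0 hu hx1 hy) hs.1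
  unfold fM at h1
  nlinarith

lemma main_aux (n : ℕ) (c : Euc n → Euc n → ℝ)
    (U V : Set (Euc n)) (u : Euc n → ℝ) (ybar : Euc n)
    (hB0 : B0cond n c U V) (hB1 : B1cond n c U V) (hB2 : B2cond n c U V)
    (hB3 : B3cond n c U V)
    (hy : ybar ∈ closure V)
    (hu : CConvexOn n c (closure U) (closure V) u) :
    (∀ r : ℝ, Convex ℝ {q ∈ clUy n c U ybar | modPot n c U ybar u q ≤ r}) ∧
    ConvexOn ℝ (clUy n c U ybar)
      (fun q => modPot n c U ybar u q + Mconst n c U V * ‖q‖ ^ 2) ∧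
    (B4cond n c U V → ConvexOn ℝ (clUy n c U ybar) (modPot n c U ybar u)) ∧
    (∀ q₀ ∈ clUy n c U ybar,
      ybar ∈ cSubdiffAt n c (closure U) (closure V) u (xOf n c U ybar q₀) →
      ∀ q ∈ clUy n c U ybar, modPot n c U ybar u q₀ ≤ modPot n c U ybar u q) ∧
    CConvexOn n (modCost n c U ybar) (clUy n c U ybar) (closure V)
      (modPot n c U ybar u) ∧
    (∀ q ∈ clUy n c U ybar,
      cSubdiffAt n (modCost n c U ybar) (clUy n c U ybar) (closure V)
          (modPot n c U ybar u) q
        = cSubdiffAt n c (closure U) (closure V) u (xOf n c U ybar q)) := by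
  have hV : V.Nonempty := closure_nonempty_iff.1 ⟨ybar, hy⟩
  have hcv := convex_clUy hB0 hB1 hB2 hy
  have hUne : ∀ x, x ∈ closure U → U.Nonempty := fun x hx => closure_nonempty_iff.1 ⟨x, hx⟩
  have hmod : ∀ x ∈ closure U,
      modPot n c U ybar u (-gradY n c x ybar) = u x + c x ybar := by
    intro x hx
    unfold modPot
    rw [xOf_eq hB1 hy hx]
  refine ⟨?_, ⟨hcv, ?_⟩, fun hB4 => ⟨hcv, ?_⟩, ?_, ?_, ?_⟩
  · rintro r q0 ⟨h0, l0⟩ q1 ⟨h1, l1⟩ a b ha hb hab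
    refine ⟨hcv h0 h1 ha hb hab, ?_⟩
    obtain ⟨x0, hx0, x1, hx1, x, hx, rfl, rfl, he, he'⟩ :=
      seg_point hB0 hB1 hB2 hy h0 h1 ha hb hab
    have hs : b ∈ Icc (0 : ℝ) 1 := ⟨hb, by linarith⟩
    rw [he, hmod x hx]
    rw [hmod x0 hx0] at l0
    rw [hmod x1 hx1] at l1
    have key := u_le hu hV hx (R := r - c x ybar) ?_
    · linarith
    intro y hy'
    have h2 := closure_quasi hB0 hB1 hB2 (hUne x hx) hV hx0 hx1 hx hy hy' hs he' hB3
    have e0 := le_star hB0 hu hx0 hy'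
    have e1 := le_star hB0 hu hx1 hy'
    simp only [fM, zero_mul, add_zero] at h2
    rcases le_max_iff.1 h2 with h3 | h3 <;> linarith
  · rintro q0 h0 q1 h1 a b ha hb hab
    obtain ⟨x0, hx0, x1, hx1, x, hx, rfl, rfl, he, he'⟩ :=
      seg_point hB0 hB1 hB2 hy h0 h1 ha hb hab
    have hs : b ∈ Icc (0 : ℝ) 1 := ⟨hb, by linarith⟩
    beta_reduce
    rw [he, hmod x hx, hmod x0 hx0, hmod x1 hx1]
    obtain rfl : a = 1 - b := by linarith
    exact assemble_lin hB0 hu hV hx0 hx1 hx hs fun y hy' =>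
      closure_semi hB0 hB1 hB2 (hUne x hx) hV hx0 hx1 hx hy hy' hs he'
  · rintro q0 h0 q1 h1 a b ha hb hab
    obtain ⟨x0, hx0, x1, hx1, x, hx, rfl, rfl, he, he'⟩ :=
      seg_point hB0 hB1 hB2 hy h0 h1 ha hb hab
    have hs : b ∈ Icc (0 : ℝ) 1 := ⟨hb, by linarith⟩
    rw [he, hmod x hx, hmod x0 hx0, hmod x1 hx1]
    obtain rfl : a = 1 - b := by linarith
    have := assemble_lin hB0 hu hV hx0 hx1 hx hs fun y hy' =>
      closure_convex hB0 hB1 hB2 (hUne x hx) hV hx0 hx1 hx hy hy' hs he' hB4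
    simpa using this
  · rintro _ ⟨x0, hx0, rfl⟩ hsub _ ⟨x, hx, rfl⟩
    beta_reduce at hsub ⊢
    rw [xOf_eq hB1 hy hx0] at hsub
    rw [hmod x hx, hmod x0 hx0]
    have h1 : u x0 + cStarT n c (closure U) u ybar + c x0 ybar = 0 := hsub.2.2
    have h2 := le_star hB0 hu hx hy
    linarith
  · rintro _ ⟨x, hx, rfl⟩
    beta_reduce
    rw [hmod x hx]
    have hset : ((fun y => -modCost n c U ybar (-gradY n c x ybar) y -
        cStarT n (modCost n c U ybar) (clUy n c U ybar) (modPot n c U ybar u) y) '' closure V)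
        = (fun y => (-c x y - cStarT n c (closure U) u y) + c x ybar) '' closure V := by
      refine image_congr fun y _ => ?_
      rw [cStarT_mod hB1 hy]
      unfold modCost
      rw [xOf_eq hB1 hy hx]
      ring
    rw [hset]
    have hlub : IsLUB ((fun y => -c x y - cStarT n c (closure U) u y) '' closure V) (u x) := by
      rw [hu x hx]
      refine isLUB_csSup (hV.closure.image _) ⟨u x, ?_⟩
      rintro _ ⟨y, hy', rfl⟩
      have := le_star hB0 hu hx hy'
      beta_reduce
      linarith
    symm
    refine IsLUB.csSup_eq ⟨?_, ?_⟩ (hV.closure.image _)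
    · rintro _ ⟨y, hy', rfl⟩
      have := hlub.1 (mem_image_of_mem (fun y => -c x y - cStarT n c (closure U) u y) hy')
      beta_reduce at this ⊢
      linarith
    · intro R hR
      have : u x ≤ R - c x ybar := by
        refine hlub.2 ?_
        rintro _ ⟨y, hy', rfl⟩
        have := hR (mem_image_of_mem
          (fun y => (-c x y - cStarT n c (closure U) u y) + c x ybar) hy')
        beta_reduce at this ⊢
        linarith
      linarith
  · rintro _ ⟨x, hx, rfl⟩
    beta_reduce
    rw [xOf_eq hB1 hy hx]
    ext y
    show (_ ∈ clUy n c U ybar ∧ y ∈ closure V ∧ modPot n c U ybar u (-gradY n c x ybar) +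
      cStarT n (modCost n c U ybar) (clUy n c U ybar) (modPot n c U ybar u) y +
      modCost n c U ybar (-gradY n c x ybar) y = 0) ↔
      (x ∈ closure U ∧ y ∈ closure V ∧ u x + cStarT n c (closure U) u y + c x y = 0)
    rw [cStarT_mod hB1 hy, hmod x hx]
    unfold modCost
    rw [xOf_eq hB1 hy hx]
    have hm : -gradY n c x ybar ∈ clUy n c U ybar :=
      mem_image_of_mem (fun x => -gradY n c x ybar) hx
    constructor
    · rintro ⟨_, h1, h2⟩
      exact ⟨hx, h1, by linarith⟩
    · rintro ⟨_, h1, h2⟩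
      exact ⟨hm, h1, by linarith⟩

end Assembly

/-- Theorem 4.3: modified `c`-convex functions appear level-set convex. -/
theorem modified_potential_levelset_convex (n : ℕ) (c : Euc n → Euc n → ℝ)
    (U V : Set (Euc n)) (u : Euc n → ℝ) (ybar : Euc n)
    (hB0 : B0cond n c U V) (hB1 : B1cond n c U V) (hB2 : B2cond n c U V)
    (hB3 : B3cond n c U V)
    (hy : ybar ∈ closure V)
    (hu : CConvexOn n c (closure U) (closure V) u) :
    -- `ũ` has convex level sets on `cl U_ȳ`
    (∀ r : ℝ, Convex ℝ {q ∈ clUy n c U ybar | modPot n c U ybar u q ≤ r}) ∧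
    -- `ũ + M_c |q|²` is convex
    ConvexOn ℝ (clUy n c U ybar)
      (fun q => modPot n c U ybar u q + Mconst n c U V * ‖q‖ ^ 2) ∧
    -- under (B4), `ũ` is convex
    (B4cond n c U V → ConvexOn ℝ (clUy n c U ybar) (modPot n c U ybar u)) ∧
    -- `ũ` is minimized at `q₀` if `ȳ ∈ ∂ᶜu(x(q₀))`
    (∀ q₀ ∈ clUy n c U ybar,
      ybar ∈ cSubdiffAt n c (closure U) (closure V) u (xOf n c U ybar q₀) →
      ∀ q ∈ clUy n c U ybar, modPot n c U ybar u q₀ ≤ modPot n c U ybar u q) ∧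
    -- `ũ` is `c̃`-convex with respect to the modified cost
    CConvexOn n (modCost n c U ybar) (clUy n c U ybar) (closure V)
      (modPot n c U ybar u) ∧
    -- `∂^{c̃}ũ(q) = ∂ᶜu(x(q))` for all `q ∈ cl U_ȳ`
    (∀ q ∈ clUy n c U ybar,
      cSubdiffAt n (modCost n c U ybar) (clUy n c U ybar) (closure V)
          (modPot n c U ybar u) q
        = cSubdiffAt n c (closure U) (closure V) u (xOf n c U ybar q)) := by
  exact main_aux n c U V u ybar hB0 hB1 hB2 hB3 hy hu
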